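/- arXiv:math/0605574 — 2 statements merged into one kernel-verified Lean document; each statement's English description precedes it below -/
import Mathlib

section
/- (Theorem A(d)) Assume R is not Gorenstein (equivalently, r ≥ 2). Suppose there exists a non-zero minimal acyclic complex A of finitely generated free R-modules such that, in addition, H_n(A*) = 0 for some integer n, where A* = Hom_R(A, R) is the dual complex. Then the Bass numbers of R satisfy μ^0_R = r and μ^i_R = r^{i−1}·(r² − 1) for all i ≥ 1; equivalently, the Bass series of R is I_R(t) = (r − t)/(1 − r·t). -/
open IsLocalRing CategoryTheory

/-- The length of an `R`-module `M`: the supremum of the lengths of strictly increasing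
chains of submodules of `M`.  For a module annihilated by the maximal ideal of a local
ring this coincides with the dimension over the residue field `k`. -/
noncomputable def moduleLength (R M : Type) [Ring R] [AddCommGroup M] [Module R M] : ℕ∞ :=
  ⨆ p : LTSeries (Submodule R M), (p.length : ℕ∞)

/-- `Ext^n_R(M, N)`, as an object of `ModuleCat R`. -/
noncomputable def extModule (R : Type) [CommRing R] (M N : Type) [AddCommGroup M] [Module R M]
    [AddCommGroup N] [Module R N] (n : ℕ) : ModuleCat R :=
  ((Ext R (ModuleCat R) n).obj (Opposite.op (ModuleCat.of R M))).obj (ModuleCat.of R N)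

/-- The `i`-th Betti number `β_i^R(M) = dim_k Ext^i_R(M, k)` of a module `M` over a local
ring `(R, m, k)`, computed as the length over `R` of `Ext^i_R(M, k)` (an `R`-module
annihilated by `m`, hence a `k`-vector space). -/
noncomputable def bettiNum (R : Type) [CommRing R] [IsLocalRing R] (M : Type) [AddCommGroup M]
    [Module R M] (i : ℕ) : ℕ∞ :=
  moduleLength R (extModule R M (ResidueField R) i).carrier

/-- The `i`-th Bass number `μ^i_R = dim_k Ext^i_R(k, R)` of a local ring `(R, m, k)`. -/
noncomputable def bassNum (R : Type) [CommRing R] [IsLocalRing R] (i : ℕ) : ℕ∞ :=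
  moduleLength R (extModule R (ResidueField R) R i).carrier

/-- The socle `Soc R = (0 :_R m)` of a local ring `(R, m)`. -/
noncomputable def socle (R : Type) [CommRing R] [IsLocalRing R] : Ideal R :=
  Submodule.colon (⊥ : Ideal R) (maximalIdeal R)

/-- The socle dimension `r = dim_k (0 :_R m)` of a local ring `(R, m, k)`. -/
noncomputable def socdim (R : Type) [CommRing R] [IsLocalRing R] : ℕ∞ :=
  moduleLength R (socle R)

/-- The embedding dimension `e = dim_k (m/m²)` of a local ring `(R, m, k)`. -/
noncomputable def embdim (R : Type) [CommRing R] [IsLocalRing R] : ℕ∞ :=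
  moduleLength R (CotangentSpace R)

/-- The residue field `k` is (isomorphic to) a direct summand of the `R`-module `M`,
expressed by a split injection `k → M`. -/
def kSummand (R : Type) [CommRing R] [IsLocalRing R] (M : Type) [AddCommGroup M]
    [Module R M] : Prop :=
  ∃ (f : M →ₗ[R] ResidueField R) (g : ResidueField R →ₗ[R] M), f ∘ₗ g = LinearMap.id

/-- Vanishing of the `i`-th homology of the dual complex `A* = Hom_R(A, R)` of a chain
complex `A` with differentials `d i : A (i+1) → A i` (so that `∂_j = d (j-1)`):
every functional on `A_i` vanishing on the image of `∂_{i+1}` factors through `∂_i`.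
(The index `i` is written as `i - 1 + 1` for type-checking reasons.)  Together with the
automatic inclusion `im ∂*_i ⊆ ker ∂*_{i+1}`, this says exactly `H_i(A*) = 0`. -/
def dualHomologyIsZero (R : Type) [CommRing R] (A : ℤ → Type) [∀ i, AddCommGroup (A i)]
    [∀ i, Module R (A i)] (d : ∀ i : ℤ, A (i + 1) →ₗ[R] A i) (i : ℤ) : Prop :=
  ∀ f : A (i - 1 + 1) →ₗ[R] R, f ∘ₗ d (i - 1 + 1) = 0 →
    ∃ g : A (i - 1) →ₗ[R] R, f = g ∘ₗ d (i - 1)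


section Aux
open CategoryTheory.Abelian

lemma moduleLength_eq (R M : Type) [Ring R] [AddCommGroup M] [Module R M] :
    moduleLength R M = Module.length R M := by
  apply WithBot.coe_injective
  rw [Module.coe_length, Order.krullDim_eq_iSup_length]
  rfl

variable {R : Type} [CommRing R]

abbrev EE (R : Type) [CommRing R] (M : Type) [AddCommGroup M] [Module R M] (n : ℕ) : Type :=
  Abelian.Ext.{0} (ModuleCat.of R M) (ModuleCat.of R R) n

noncomputable def pull {M N : Type} [AddCommGroup M] [Module R M] [AddCommGroup N] [Module R N]
    (f : M →ₗ[R] N) (n : ℕ) : EE R N n →ₗ[R] EE R M n :=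
  (Abelian.Ext.mk₀ (ModuleCat.ofHom f)).precompOfLinear R (ModuleCat.of R R) (zero_add n)

section
variable {M N P : Type} [AddCommGroup M] [Module R M] [AddCommGroup N] [Module R N]
  [AddCommGroup P] [Module R P]

lemma pull_apply (f : M →ₗ[R] N) (n : ℕ) (x : EE R N n) :
    pull f n x = (Abelian.Ext.mk₀ (ModuleCat.ofHom f)).comp x (zero_add n) := rfl

lemma pull_comp (f : M →ₗ[R] N) (g : N →ₗ[R] P) (n : ℕ) (x : EE R P n) :
    pull f n (pull g n x) = pull (g ∘ₗ f) n x := by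
  simp only [pull_apply, ModuleCat.ofHom_comp]
  rw [Abelian.Ext.mk₀_comp_mk₀_assoc]

lemma pull_id (n : ℕ) (x : EE R M n) : pull (LinearMap.id : M →ₗ[R] M) n x = x := by
  simp only [pull_apply, ModuleCat.ofHom_id]
  simp

lemma pull_add (f g : M →ₗ[R] N) (n : ℕ) (x : EE R N n) :
    pull (f + g) n x = pull f n x + pull g n x := by
  simp only [pull_apply, ModuleCat.ofHom_add, Abelian.Ext.mk₀_add, Abelian.Ext.add_comp]

lemma pull_zero (n : ℕ) (x : EE R N n) :
    pull (0 : M →ₗ[R] N) n x = 0 := by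
  simpa using pull_add (0 : M →ₗ[R] N) 0 n x

lemma pull_sum {ι : Type} (s : Finset ι) (f : ι → M →ₗ[R] N) (n : ℕ) (x : EE R N n) :
    pull (∑ i ∈ s, f i) n x = ∑ i ∈ s, pull (f i) n x := by
  classical
  induction s using Finset.induction_on with
  | empty => simp [pull_zero]
  | insert a s ha ih => rw [Finset.sum_insert ha, Finset.sum_insert ha, pull_add, ih]

/-- the short complex of modules -/
noncomputable def mkS (f : M →ₗ[R] N) (g : N →ₗ[R] P) (h : Function.Exact f g) :
    ShortComplex (ModuleCat.{0} R) :=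
  ShortComplex.mk (ModuleCat.ofHom f) (ModuleCat.ofHom g) (by
    ext x; exact h.apply_apply_eq_zero x)

lemma mkS_shortExact (f : M →ₗ[R] N) (g : N →ₗ[R] P) (h : Function.Exact f g)
    (hf : Function.Injective f) (hg : Function.Surjective g) : (mkS f g h).ShortExact where
  exact := (ShortComplex.ShortExact.moduleCat_exact_iff_function_exact _).2 h
  mono_f := (ModuleCat.mono_iff_injective _).2 hf
  epi_g := (ModuleCat.epi_iff_surjective _).2 hg

lemma les (f : M →ₗ[R] N) (g : N →ₗ[R] P) (h : Function.Exact f g)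
    (hf : Function.Injective f) (hg : Function.Surjective g) (n : ℕ) :
    Function.Exact (pull g n) (pull f n) ∧
    ∃ δ : EE R M n →ₗ[R] EE R P (n + 1), Function.Exact (pull f n) δ ∧
      Function.Exact δ (pull g (n + 1)) := by
  have hS := mkS_shortExact f g h hf hg
  have hc : ∀ n (x : EE R P n), pull f n (pull g n x) = 0 := by
    intro n x
    rw [pull_comp, h.linearMap_comp_eq_zero, pull_zero]
  refine ⟨fun x => ⟨fun hx => ?_, ?_⟩, hS.extClass.precompOfLinear R _ (add_comm 1 n),
    fun x => ⟨fun hx => ?_, ?_⟩, fun x => ⟨fun hx => ?_, ?_⟩⟩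
  · exact Abelian.Ext.contravariant_sequence_exact₂ hS _ x hx
  · rintro ⟨y, rfl⟩; exact hc n y
  · exact Abelian.Ext.contravariant_sequence_exact₁ hS _ x (add_comm 1 n) hx
  · rintro ⟨y, rfl⟩
    exact (ShortComplex.ab_exact_iff_function_exact _).1
      (Abelian.Ext.contravariant_sequence_exact₁' hS (ModuleCat.of R R) n (n+1) (add_comm 1 n))
      |>.apply_apply_eq_zero y
  · exact Abelian.Ext.contravariant_sequence_exact₃ hS _ x hx (add_comm 1 n)
  · rintro ⟨y, rfl⟩
    exact (ShortComplex.ab_exact_iff_function_exact _).1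
      (Abelian.Ext.contravariant_sequence_exact₃' hS (ModuleCat.of R R) n (n+1) (add_comm 1 n))
      |>.apply_apply_eq_zero y

lemma EE_free_subsingleton [Module.Free R M] (n : ℕ) : Subsingleton (EE R M (n + 1)) := by
  have : Projective (ModuleCat.of R M) := ModuleCat.projective_of_free (Module.Free.chooseBasis R M)
  exact ⟨fun x y => (Abelian.Ext.eq_zero_of_projective x).trans
    (Abelian.Ext.eq_zero_of_projective y).symm⟩

lemma pull_injective_of_surjective (g : N →ₗ[R] P) (hg : Function.Surjective g) :
    Function.Injective (pull g 0) := by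
  have : Epi (ModuleCat.ofHom g) := (ModuleCat.epi_iff_surjective _).2 hg
  exact Abelian.Ext.precomp_mk₀_injective_of_epi (ModuleCat.of R R) (ModuleCat.ofHom g)

noncomputable def EE0 (M : Type) [AddCommGroup M] [Module R M] : EE R M 0 ≃ₗ[R] (M →ₗ[R] R) :=
  Abelian.Ext.linearEquiv₀.trans ModuleCat.homLinearEquiv

lemma EE0_symm (f : M →ₗ[R] R) : (EE0 M).symm f = Abelian.Ext.mk₀ (ModuleCat.ofHom f) := by
  rfl

lemma pull_EE0_symm (g : M →ₗ[R] N) (f : N →ₗ[R] R) :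
    pull g 0 ((EE0 N).symm f) = (EE0 M).symm (f ∘ₗ g) := by
  rw [EE0_symm, EE0_symm, pull_apply, Abelian.Ext.mk₀_comp_mk₀]; rfl

end
end Aux

section Aux2
open CategoryTheory.Abelian
variable {R : Type} [CommRing R]

noncomputable def cocyc {X : ModuleCat.{0} R} (P : ProjectiveResolution X) (Y : ModuleCat.{0} R)
    (n : ℕ) : Submodule R (P.complex.X n ⟶ Y) :=
  LinearMap.ker (Linear.leftComp R Y (P.complex.d (n + 1) n))

lemma mem_cocyc {X : ModuleCat.{0} R} (P : ProjectiveResolution X) (Y : ModuleCat.{0} R)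
    (n : ℕ) (f : P.complex.X n ⟶ Y) : f ∈ cocyc P Y n ↔ P.complex.d (n + 1) n ≫ f = 0 := Iff.rfl

noncomputable def extMkLin {X : ModuleCat.{0} R} (P : ProjectiveResolution X) 
    (Y : ModuleCat.{0} R) (n : ℕ) :
    cocyc P Y n →ₗ[R] Abelian.Ext.{0} X Y n where
  toFun f := P.extMk f.1 (n + 1) rfl ((mem_cocyc _ _ _ _).1 f.2)
  map_add' f g := (P.add_extMk _ _ _ _ _ _).symm
  map_smul' r f := by
    rw [Abelian.Ext.smul_eq_comp_mk₀, RingHom.id_apply, P.extMk_comp_mk₀]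
    congr 1

lemma extMkLin_surj {X Y : ModuleCat.{0} R} (P : ProjectiveResolution X) (n : ℕ) :
    Function.Surjective (extMkLin P Y n) := by
  intro α
  obtain ⟨f, hf, h⟩ := P.extMk_surjective α (n + 1) rfl
  exact ⟨⟨f, hf⟩, h⟩

noncomputable def homol0 {X : ModuleCat.{0} R} (P : ProjectiveResolution X) 
    (Y : ModuleCat.{0} R) :
    cocyc P Y 0 ≃ₗ[R] ((P.complex.linearYonedaObj R Y).homology 0 : ModuleCat.{0} R) := by
  have i1 := (CochainComplex.isoHomologyπ₀ (P.complex.linearYonedaObj R Y)).toLinearEquiv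
  have i2 : (P.complex.linearYonedaObj R Y).sc 0 ≅ (P.complex.linearYonedaObj R Y).sc' 0 0 1 :=
    (P.complex.linearYonedaObj R Y).isoSc' 0 0 1 (by simp) (by simp)
  have i3 := (ShortComplex.cyclesMapIso i2).toLinearEquiv
  have i4 := ((P.complex.linearYonedaObj R Y).sc' 0 0 1).moduleCatCyclesIso.toLinearEquiv
  exact (i1.symm.trans (i3.trans i4)).symm

lemma homolS {X : ModuleCat.{0} R} (P : ProjectiveResolution X) 
    (Y : ModuleCat.{0} R) (n : ℕ) :
    ∃ φ : cocyc P Y (n+1) →ₗ[R] ((P.complex.linearYonedaObj R Y).homology (n+1) : ModuleCat.{0} R),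
     Function.Surjective φ ∧ ∀ f, φ f = 0 ↔ ∃ (g : P.complex.X n ⟶ Y), P.complex.d (n+1) n ≫ g = f.1 := by
  let K := P.complex.linearYonedaObj R Y
  have i2 : K.homology (n+1) ≅ (K.sc' n (n+1) (n+1+1)).homology :=
    K.homologyIsoSc' n (n+1) (n+1+1) (by simp) (by simp)
  have i3 := (i2 ≪≫ (K.sc' n (n+1) (n+1+1)).moduleCatHomologyIso).toLinearEquiv
  let T := K.sc' n (n+1) (n+1+1)
  have key : ∃ φ : LinearMap.ker (ModuleCat.Hom.hom T.g) →ₗ[R] (K.homology (n+1) : ModuleCat.{0} R),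
      Function.Surjective φ ∧ ∀ f, φ f = 0 ↔ f ∈ LinearMap.range T.moduleCatToCycles := by
    let j : (LinearMap.ker (ModuleCat.Hom.hom T.g) ⧸ LinearMap.range T.moduleCatToCycles) ≃ₗ[R]
      (K.homology (n+1) : ModuleCat.{0} R) := i3.symm
    refine ⟨j.toLinearMap ∘ₗ Submodule.mkQ (LinearMap.range T.moduleCatToCycles), ?_, ?_⟩
    · exact j.surjective.comp (Submodule.mkQ_surjective _)
    · intro f
      simp
  obtain ⟨φ, h1, h2⟩ := key
  refine ⟨φ, h1, fun f => (h2 f).trans ?_⟩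
  constructor
  · rintro ⟨g, hg⟩
    exact ⟨g, congrArg Subtype.val hg⟩
  · rintro ⟨g, hg⟩
    exact ⟨g, Subtype.ext hg⟩

lemma length_eq_of_surj {K A B : Type} [AddCommGroup K] [Module R K] [AddCommGroup A] [Module R A]
    [AddCommGroup B] [Module R B] (f : K →ₗ[R] A) (g : K →ₗ[R] B) (hf : Function.Surjective f)
    (hg : Function.Surjective g) (h : ∀ x, f x = 0 ↔ g x = 0) :
    Module.length R A = Module.length R B := by
  have : LinearMap.ker f = LinearMap.ker g := by ext x; exact h x
  exact ((f.quotKerEquivOfSurjective hf).symm.trans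
    ((Submodule.quotEquivOfEq _ _ this).trans (g.quotKerEquivOfSurjective hg))).length_eq

lemma length_cocyc0 {X : ModuleCat.{0} R} (P : ProjectiveResolution X) 
    (Y : ModuleCat.{0} R) : Module.length R (X ⟶ Y) = Module.length R (cocyc P Y 0) := by
  let φ : (X ⟶ Y) →ₗ[R] cocyc P Y 0 := LinearMap.codRestrict _ 
    (Linear.leftComp R Y (P.π.f 0)) (by
      intro c
      rw [mem_cocyc]
      exact P.complex_d_comp_π_f_zero_assoc c |>.trans Limits.zero_comp)
  have hφ : Function.Bijective φ := by
    constructor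
    · intro a b hab
      have h2 : P.π.f 0 ≫ a = P.π.f 0 ≫ b := congrArg Subtype.val hab
      exact (cancel_epi (P.π.f 0)).1 h2
    · rintro ⟨f, hf⟩
      rw [mem_cocyc] at hf
      refine ⟨P.exact₀.gIsCokernel.desc (Limits.CokernelCofork.ofπ f hf), Subtype.ext ?_⟩
      exact P.exact₀.gIsCokernel.fac (Limits.CokernelCofork.ofπ f hf) Limits.WalkingParallelPair.one
  exact (LinearEquiv.ofBijective φ hφ).length_eq

lemma length_extModule (M N : Type) [AddCommGroup M] [Module R M] [AddCommGroup N] [Module R N]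
    (n : ℕ) : moduleLength R (extModule R M N n) =
      Module.length R (Abelian.Ext.{0} (ModuleCat.of R M) (ModuleCat.of R N) n) := by
  rw [moduleLength_eq]
  let P := projectiveResolution (ModuleCat.of R M)
  have i := (P.isoExt (R := R) n (ModuleCat.of R N)).toLinearEquiv
  refine i.length_eq.trans ?_
  cases n with
  | zero => 
    rw [← (homol0 P (ModuleCat.of R N)).length_eq, ← length_cocyc0]
    exact Abelian.Ext.linearEquiv₀.symm.length_eq
  | succ n =>
    obtain ⟨φ, h1, h2⟩ := homolS P (ModuleCat.of R N) n
    refine length_eq_of_surj φ (extMkLin P (ModuleCat.of R N) (n+1)) h1 (extMkLin_surj P _) ?_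
    intro f
    rw [h2]
    exact (P.extMk_eq_zero_iff f.1 (n+1+1) rfl f.2 n rfl).symm

end Aux2

/-- numeric lemma -/
lemma numeric_seq (c : ℕ → ℕ) (e s : ℕ) (hs : 2 ≤ s) (hpos : ∀ j, 0 < c j)
    (hrec : ∀ j, e * c (j + 1) = c j + s * c (j + 2)) : e = s + 1 := by
  have hD : ∀ j, (s : ℤ) * ((c (j+1) : ℤ) * c (j+3) - c (j+2) ^ 2)
      = (c j : ℤ) * c (j+2) - c (j+1) ^ 2 := by
    intro j
    have h1 : (e : ℤ) * c (j + 1) = c j + s * c (j + 2) := by exact_mod_cast hrec j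
    have h2 : (e : ℤ) * c (j + 2) = c (j+1) + s * c (j + 3) := by exact_mod_cast hrec (j+1)
    linear_combination (-(c (j+1) : ℤ)) * h2 + (c (j+2) : ℤ) * h1
  have hpow : ∀ i j, ((s : ℤ) ^ i) ∣ (c j : ℤ) * c (j+2) - c (j+1) ^ 2 := by
    intro i
    induction i with
    | zero => intro j; simp
    | succ i ih =>
      intro j
      rw [← hD j, pow_succ']
      exact mul_dvd_mul_left _ (ih (j+1))
  have hzero : ∀ j, (c j : ℤ) * c (j+2) - c (j+1) ^ 2 = 0 := by
    intro j
    by_contra h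
    set D := (c j : ℤ) * c (j+2) - c (j+1) ^ 2 with hDdef
    have h1 := Int.le_of_dvd (by positivity) ((dvd_abs _ _).2 (hpow D.natAbs j))
    have h2 : D.natAbs < s ^ D.natAbs := Nat.lt_pow_self (by omega)
    have h3 : |D| = (D.natAbs : ℤ) := Int.abs_eq_natAbs D
    rw [h3] at h1
    have : s ^ D.natAbs ≤ D.natAbs := by exact_mod_cast h1
    omega
  have hz : ∀ j, c j * c (j+2) = c (j+1) * c (j+1) := by
    intro j
    have := hzero j
    have h : (c j : ℤ) * c (j+2) = c (j+1) * c (j+1) := by linear_combination this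
    exact_mod_cast h
  have hdvd : c 1 ∣ c 0 := by
    have h1 : e * (c 0 * c 1) = c 0 ^ 2 + s * c 1 ^ 2 := by
      have := hrec 0
      have := hz 0
      simp only [zero_add] at *
      calc e * (c 0 * c 1) = c 0 * (e * c 1) := by ring
        _ = c 0 ^ 2 + s * (c 0 * c 2) := by rw [hrec 0]; ring
        _ = _ := by rw [hz 0]; ring
    obtain ⟨g, a, b, hg, hab, h0, h1'⟩ := Nat.exists_coprime' (m := c 0) (n := c 1)
      (Nat.gcd_pos_of_pos_left _ (hpos 0))
    rw [h0, h1'] at h1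
    have h2 : e * (a * b) = a ^ 2 + s * b ^ 2 := by
      have : g ^ 2 * (e * (a * b)) = g ^ 2 * (a ^ 2 + s * b ^ 2) := by nlinarith
      exact Nat.eq_of_mul_eq_mul_left (by positivity) this
    have h3 : b ∣ a ^ 2 := by
      have : b ∣ a ^ 2 + s * b ^ 2 := ⟨e * a, by rw [← h2]; ring⟩
      exact (Nat.dvd_add_left (Dvd.intro_left (s * b) (by ring))).1 this
    have h4 : b = 1 := Nat.Coprime.eq_one_of_dvd (Nat.Coprime.pow_right 2 hab.symm) h3
    rw [h0, h1', h4]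
    exact ⟨a, by ring⟩
  obtain ⟨t, ht⟩ := hdvd
  have hall : ∀ j, c j = c (j+1) * t := by
    intro j
    induction j with
    | zero => exact ht
    | succ j ih =>
      have := hz j
      rw [ih] at this
      have h : c (j+1) * (c (j+2) * t) = c (j+1) * c (j+1) := by rw [← this]; ring
      exact (Nat.eq_of_mul_eq_mul_left (hpos _) h).symm
  have hp : ∀ j, c 0 = c j * t ^ j := by
    intro j
    induction j with
    | zero => simp
    | succ j ih => rw [ih, hall j]; ring
  have ht0 : 0 < t := by
    rcases Nat.eq_zero_or_pos t with h | h
    · have := hpos 0; rw [ht, h] at this; simp at this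
    · exact h
  have ht1 : t = 1 := by
    by_contra hne
    have h2 : c 0 < t ^ c 0 := Nat.lt_pow_self (by omega)
    have h3 := hp (c 0)
    have h4 := hpos (c 0)
    nlinarith [Nat.le_mul_of_pos_left (t ^ c 0) h4]
  have e0 := hall 0
  have e1 := hall 1
  have e2 := hrec 0
  simp only [ht1, mul_one, zero_add, Nat.reduceAdd] at e0 e1 e2
  rw [e0, ← e1] at e2
  have : e * c 1 = (s + 1) * c 1 := by rw [e2]; ring
  exact Nat.eq_of_mul_eq_mul_right (hpos 1) this

section Len
variable {R : Type} [CommRing R]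

noncomputable def len (R M : Type) [CommRing R] [AddCommGroup M] [Module R M] : ℕ :=
  (Module.length R M).toNat

section
variable {M N P : Type} [AddCommGroup M] [Module R M] [AddCommGroup N] [Module R N]
  [AddCommGroup P] [Module R P]

lemma len_equiv (e : M ≃ₗ[R] N) : len R M = len R N := by
  rw [len, len, e.length_eq]

lemma coe_len [IsArtinian R M] [IsNoetherian R M] : (len R M : ℕ∞) = Module.length R M :=
  ENat.natCast_toNat Module.length_ne_top

lemma len_exact [IsArtinian R N] [IsNoetherian R N] (f : M →ₗ[R] N) (g : N →ₗ[R] P)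
    (hf : Function.Injective f) (hg : Function.Surjective g) (h : Function.Exact f g) :
    len R N = len R M + len R P := by
  have : IsArtinian R M := isArtinian_of_injective f hf
  have : IsNoetherian R M := isNoetherian_of_injective f hf
  have : IsArtinian R P := isArtinian_of_surjective _ g hg
  have : IsNoetherian R P := isNoetherian_of_surjective g (LinearMap.range_eq_top.2 hg)
  have := Module.length_eq_add_of_exact f g hf hg h
  rw [← coe_len, ← coe_len, ← coe_len] at this
  exact_mod_cast this

lemma len_ker_range [IsArtinian R M] [IsNoetherian R M] (f : M →ₗ[R] N) :
    len R M = len R (LinearMap.ker f) + len R (LinearMap.range f) :=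
  len_exact (LinearMap.ker f).subtype f.rangeRestrict (Submodule.injective_subtype _)
    f.surjective_rangeRestrict (by
      rw [LinearMap.exact_iff]; simp)

lemma len_sub_quot [IsArtinian R M] [IsNoetherian R M] (p : Submodule R M) :
    len R M = len R p + len R (M ⧸ p) :=
  len_exact p.subtype p.mkQ (Submodule.injective_subtype _) (Submodule.mkQ_surjective _) (by
      rw [LinearMap.exact_iff]; simp)

lemma len_eq_zero [IsArtinian R M] [IsNoetherian R M] : len R M = 0 ↔ Subsingleton M := by
  rw [← Module.length_eq_zero_iff (R := R), ← coe_len]; simp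

lemma len_pi {ι : Type} [Fintype ι] [IsArtinian R M] [IsNoetherian R M] :
    len R (ι → M) = Fintype.card ι * len R M := by
  rw [len, Module.length_pi, ENat.toNat_mul, len]; simp

lemma len_smul_top [IsArtinianRing R] [IsNoetherianRing R] [Module.Free R M] [Module.Finite R M]
    [Nontrivial R]
    (I : Ideal R) : len R (I • (⊤ : Submodule R M) : Submodule R M) =
      Module.finrank R M * len R I := by
  let b := Module.Free.chooseBasis R M
  let φ : (Module.Free.ChooseBasisIndex R M → I) →ₗ[R] M :=
    ∑ i, (LinearMap.toSpanSingleton R M (b i)) ∘ₗ I.subtype ∘ₗ LinearMap.proj i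
  have hφ : ∀ y, φ y = ∑ i, (y i : R) • b i := by
    intro y; simp [φ, LinearMap.sum_apply]
  have hinj : Function.Injective φ := by
    intro x y hxy
    rw [hφ, hφ] at hxy
    funext i
    apply Subtype.ext
    have := congrArg (fun z => b.repr z i) hxy
    simpa [Finsupp.single_apply] using this
  have hr : LinearMap.range φ = I • (⊤ : Submodule R M) := by
    ext x
    rw [← b.span_eq, Submodule.mem_ideal_smul_span_iff_exists_sum, LinearMap.mem_range]
    constructor
    · rintro ⟨y, rfl⟩
      refine ⟨Finsupp.equivFunOnFinite.symm (fun i => (y i : R)), fun i => (y i).2, ?_⟩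
      rw [hφ, Finsupp.sum_fintype _ _ (by simp)]
      rfl
    · rintro ⟨a, ha, rfl⟩
      refine ⟨fun i => ⟨a i, ha i⟩, ?_⟩
      rw [hφ, Finsupp.sum_fintype _ _ (by simp)]
  rw [← hr, ← len_equiv (LinearEquiv.ofInjective φ hinj), len_pi,
    Module.finrank_eq_card_chooseBasisIndex]

lemma len_hom_quot (I : Ideal R) :
    len R ((R ⧸ I) →ₗ[R] R) = len R (Submodule.colon (⊥ : Ideal R) (I : Set R)) := by
  let φ : ((R ⧸ I) →ₗ[R] R) →ₗ[R] R := LinearMap.applyₗ (Ideal.Quotient.mk I 1)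
  have hφ : ∀ f, φ f = f (Ideal.Quotient.mk I 1) := fun f => rfl
  have hinj : Function.Injective φ := by
    intro f g h
    apply LinearMap.ext
    intro x
    obtain ⟨x, rfl⟩ := Ideal.Quotient.mk_surjective x
    have hx : (Ideal.Quotient.mk I x) = x • (Ideal.Quotient.mk I 1) := by
      rw [← Ideal.Quotient.mk_eq_mk, ← Ideal.Quotient.mk_eq_mk, ← Submodule.Quotient.mk_smul]
      simp
    rw [hx, map_smul, map_smul]
    rw [hφ, hφ] at h; rw [h]
  have hr : LinearMap.range φ = Submodule.colon (⊥ : Ideal R) (I : Set R) := by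
    ext a
    rw [LinearMap.mem_range, Submodule.mem_colon]
    constructor
    · rintro ⟨f, rfl⟩ x hx
      rw [hφ, Submodule.mem_bot, smul_eq_mul, mul_comm, ← smul_eq_mul, ← map_smul]
      have : x • (Ideal.Quotient.mk I 1) = 0 := by
        rw [← Ideal.Quotient.mk_eq_mk, ← Submodule.Quotient.mk_smul]
        rw [Submodule.Quotient.mk_eq_zero]
        simpa using hx
      rw [this, map_zero]
    · intro h
      refine ⟨Submodule.liftQ I (LinearMap.toSpanSingleton R R a) ?_, ?_⟩
      · intro x hx
        have := h x hx
        simpa [mul_comm] using this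
      · rw [hφ, ← Ideal.Quotient.mk_eq_mk, Submodule.liftQ_apply]; simp
  rw [← hr, ← len_equiv (LinearEquiv.ofInjective φ hinj)]

end

variable [IsLocalRing R]

lemma exists_functional {M : Type} [AddCommGroup M] [Module R M] (x : M)
    (hx : x ∉ maximalIdeal R • (⊤ : Submodule R M)) :
    ∃ g : M →ₗ[R] ResidueField R, g x = 1 := by
  have h0 : (Submodule.mkQ (maximalIdeal R • (⊤ : Submodule R M))) x ≠ 0 := by
    simpa using hx
  let _ : Module (ResidueField R) (M ⧸ maximalIdeal R • (⊤ : Submodule R M)) := 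
    inferInstanceAs (Module (R ⧸ maximalIdeal R) (M ⧸ maximalIdeal R • (⊤ : Submodule R M)))
  have _ : IsScalarTower R (ResidueField R) (M ⧸ maximalIdeal R • (⊤ : Submodule R M)) := 
    inferInstanceAs (IsScalarTower R (R ⧸ maximalIdeal R) (M ⧸ maximalIdeal R • (⊤ : Submodule R M)))
  obtain ⟨f, hf⟩ := Module.Projective.exists_dual_eq_one (ResidueField R) h0
  exact ⟨(f.restrictScalars R) ∘ₗ Submodule.mkQ _, hf⟩

end Len

section Kx
set_option linter.unusedSectionVars false
variable {R : Type} [CommRing R] [IsLocalRing R]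

lemma exists_equiv_pi {V : Type} [AddCommGroup V] [Module R V] [Module.Finite R V]
    (h : ∀ a ∈ maximalIdeal R, ∀ v : V, a • v = 0) :
    ∃ d : ℕ, Nonempty (V ≃ₗ[R] (Fin d → ResidueField R)) := by
  have ht : Module.IsTorsionBySet R V (maximalIdeal R : Set R) := fun v a => h a a.2 v
  let _ : Module (ResidueField R) V := ht.module
  have _ : IsScalarTower R (ResidueField R) V := ht.isScalarTower
  have _ : Module.Finite (ResidueField R) V := Module.Finite.of_restrictScalars_finite R _ V
  exact ⟨_, ⟨(Module.finBasis (ResidueField R) V).equivFun.restrictScalars R⟩⟩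

lemma len_k : len R (ResidueField R) = 1 := by
  have : IsSimpleModule R (ResidueField R) := 
    isSimpleModule_iff_quot_maximal.2 ⟨maximalIdeal R, inferInstance, ⟨LinearEquiv.refl R _⟩⟩
  rw [len, Module.length_eq_one]; rfl

noncomputable def EEequiv {M N : Type} [AddCommGroup M] [Module R M] [AddCommGroup N] [Module R N]
    (e : M ≃ₗ[R] N) (n : ℕ) : EE R N n ≃ₗ[R] EE R M n :=
  LinearEquiv.ofLinearMap (pull e.toLinearMap n) (pull e.symm.toLinearMap n)
    (by ext x; simp [pull_comp, pull_id]) (by ext x; simp [pull_comp, pull_id])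

noncomputable def EEpi {M : Type} [AddCommGroup M] [Module R M] (d n : ℕ) :
    EE R (Fin d → M) n ≃ₗ[R] (Fin d → EE R M n) :=
  LinearEquiv.ofLinearMap (LinearMap.pi fun i => pull (LinearMap.single R (fun _ => M) i) n)
    (∑ i, pull (LinearMap.proj i : (Fin d → M) →ₗ[R] M) n ∘ₗ LinearMap.proj i)
    (by
      apply LinearMap.ext; intro y; funext i
      simp only [LinearMap.comp_apply, LinearMap.pi_apply, LinearMap.sum_apply, map_sum, pull_comp,
        LinearMap.id_apply, LinearMap.proj_apply]
      rw [Finset.sum_eq_single i]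
      · rw [LinearMap.proj_comp_single_same, pull_id]
      · intro j _ hj
        rw [LinearMap.proj_comp_single_ne R (fun _ => M) j i hj, pull_zero]
      · simp)
    (by
      apply LinearMap.ext; intro y
      simp only [LinearMap.comp_apply, LinearMap.pi_apply, LinearMap.sum_apply, pull_comp,
        LinearMap.id_apply, LinearMap.proj_apply]
      rw [← pull_sum]
      have this : ∑ i, LinearMap.single R (fun _ => M) i ∘ₗ (LinearMap.proj i : (Fin d → M) →ₗ[R] M)
          = LinearMap.id := by
        apply LinearMap.ext
        intro v
        funext j
        simp [Finset.sum_apply, Pi.single_apply]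
      rw [this, pull_id])

variable [IsNoetherianRing R] [IsArtinianRing R]

lemma len_EE_vec {V : Type} [AddCommGroup V] [Module R V] [Module.Finite R V]
    (h : ∀ a ∈ maximalIdeal R, ∀ v : V, a • v = 0) (n : ℕ) :
    len R (EE R V n) = len R V * len R (EE R (ResidueField R) n) := by
  obtain ⟨d, ⟨e⟩⟩ := exists_equiv_pi h
  rw [len_equiv e, len_equiv (EEequiv e n).symm, len_equiv (EEpi d n), len_pi, len_pi, len_k]
  simp

lemma len_EE_0_quot (I : Ideal R) : len R (EE R (R ⧸ I) 0) =
    len R (Submodule.colon (⊥ : Ideal R) (I : Set R)) := by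
  rw [len_equiv (EE0 _), len_hom_quot]

/-- the projection `R / m² → k` -/
noncomputable def piMap (R : Type) [CommRing R] [IsLocalRing R] :
    (R ⧸ (maximalIdeal R ^ 2)) →ₗ[R] ResidueField R :=
  Submodule.factor (p := maximalIdeal R ^ 2) (p' := maximalIdeal R) (Ideal.pow_le_self two_ne_zero)

lemma piMap_mk (x : R) : piMap R (Submodule.Quotient.mk x) = residue R x := rfl

lemma piMap_surj : Function.Surjective (piMap R) := by
  intro y
  obtain ⟨x, rfl⟩ := residue_surjective y
  exact ⟨Submodule.Quotient.mk x, rfl⟩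

lemma pull_piMap_zero {M : Type} [AddCommGroup M] [Module R M] (x : M)
    (hx : x ∉ maximalIdeal R • (⊤ : Submodule R M)) (h2 : ∀ a ∈ maximalIdeal R ^ 2, a • x = 0)
    (n : ℕ) [Subsingleton (EE R M n)] (y : EE R (ResidueField R) n) :
    pull (piMap R) n y = 0 := by
  obtain ⟨g, hg⟩ := exists_functional x hx
  let f : (R ⧸ (maximalIdeal R ^ 2)) →ₗ[R] M :=
    Submodule.liftQ _ (LinearMap.toSpanSingleton R M x) (fun a ha => by simpa using h2 a ha)
  have : piMap R = g ∘ₗ f := by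
    apply Submodule.linearMap_qext
    apply LinearMap.ext_ring
    change residue R 1 = g ((1 : R) • x)
    rw [one_smul, hg, map_one]
  rw [this, ← pull_comp, Subsingleton.elim (pull g n y) 0, map_zero]

lemma EE_k_subsingleton {M : Type} [AddCommGroup M] [Module R M] (x : M)
    (hx : x ∉ maximalIdeal R • (⊤ : Submodule R M)) (h2 : ∀ a ∈ maximalIdeal R, a • x = 0)
    (n : ℕ) [Subsingleton (EE R M n)] : Subsingleton (EE R (ResidueField R) n) := by
  obtain ⟨g, hg⟩ := exists_functional x hx
  let f : ResidueField R →ₗ[R] M :=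
    Submodule.liftQ (maximalIdeal R) (LinearMap.toSpanSingleton R M x) (fun a ha => by simpa using h2 a ha)
  have : (LinearMap.id : ResidueField R →ₗ[R] ResidueField R) = g ∘ₗ f := by
    apply LinearMap.ext
    intro y
    obtain ⟨a, rfl⟩ := residue_surjective y
    change residue R a = g (a • x)
    rw [map_smul, hg, Algebra.smul_def, mul_one]
    rfl
  refine ⟨fun y z => ?_⟩
  have h : ∀ y : EE R (ResidueField R) n, y = 0 := fun y => by
    have h1 := pull_id (M := ResidueField R) n y
    rw [this, ← pull_comp, Subsingleton.elim (pull g n y) 0, map_zero] at h1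
    exact h1.symm
  rw [h y, h z]

/-- the kernel of `R/m² → k`, i.e. `m/m²` -/
abbrev mm (R : Type) [CommRing R] [IsLocalRing R] : Type := LinearMap.ker (piMap R)

lemma mm_kill : ∀ a ∈ maximalIdeal R, ∀ v : mm R, a • v = 0 := by
  rintro a ha ⟨v, hv⟩
  apply Subtype.ext
  obtain ⟨x, rfl⟩ := Submodule.Quotient.mk_surjective _ v
  have hx : x ∈ maximalIdeal R := by
    rw [LinearMap.mem_ker, piMap_mk] at hv
    exact (residue_eq_zero_iff x).1 hv
  change a • Submodule.Quotient.mk x = 0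
  rw [← Submodule.Quotient.mk_smul, Submodule.Quotient.mk_eq_zero, smul_eq_mul, pow_two]
  exact Ideal.mul_mem_mul ha hx

section main
variable (h3 : maximalIdeal R ^ 3 = ⊥) (h2 : maximalIdeal R ^ 2 ≠ ⊥)
  (hz : ∀ n, 1 ≤ n → ∀ y : EE R (ResidueField R) n, pull (piMap R) n y = 0)

/-- Bass number as a natural number -/
noncomputable abbrev mu (R : Type) [CommRing R] [IsLocalRing R] (n : ℕ) : ℕ :=
  len R (EE R (ResidueField R) n)

lemma mm_exact : Function.Exact (LinearMap.ker (piMap R)).subtype (piMap R) := by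
  rw [LinearMap.exact_iff]; simp

lemma len_m : len R (maximalIdeal R) = len R (mm R) + len R ↥(maximalIdeal R ^ 2) := by
  have e1 := len_sub_quot (maximalIdeal R ^ 2)
  have e2 := len_exact _ _ (Submodule.injective_subtype _) piMap_surj (mm_exact (R := R))
  have e3 := len_sub_quot (maximalIdeal R)
  have e4 : len R (R ⧸ maximalIdeal R) = len R (ResidueField R) := rfl
  change len R _ = len R (mm R) + _ at e2
  omega

lemma len_R : len R R = len R (mm R) + len R ↥(maximalIdeal R ^ 2) + 1 := by
  have e3 := len_sub_quot (maximalIdeal R)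
  have e4 : len R (R ⧸ maximalIdeal R) = len R (ResidueField R) := rfl
  rw [len_m, e4, len_k] at e3
  exact e3

include h2 h3 in
lemma colon_m2 : Submodule.colon (⊥ : Ideal R) ((maximalIdeal R ^ 2 : Ideal R) : Set R)
    = maximalIdeal R := by
  ext a
  rw [Submodule.mem_colon]
  constructor
  · intro h
    by_contra ha
    rw [mem_maximalIdeal, mem_nonunits_iff, not_not] at ha
    apply h2
    rw [eq_bot_iff]
    intro x hx
    have := h x hx
    rw [Submodule.mem_bot, smul_eq_mul] at this
    exact (Submodule.mem_bot R).2 (ha.mul_right_eq_zero.1 this)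
  · intro ha x hx
    rw [← h3, smul_eq_mul, pow_succ']
    exact Ideal.mul_mem_mul ha hx

include h3 in
lemma m2_kill : ∀ a ∈ maximalIdeal R, ∀ v : ↥(maximalIdeal R ^ 2), a • v = 0 := by
  rintro a ha ⟨v, hv⟩
  apply Subtype.ext
  have : a * v ∈ maximalIdeal R ^ 3 := by
    rw [pow_succ']
    exact Ideal.mul_mem_mul ha hv
  rw [h3] at this
  exact this

include hz in
lemma N_gen (j : ℕ) (hj : 1 ≤ j) :
    len R (mm R) * mu R j = len R (EE R (R ⧸ maximalIdeal R ^ 2) j) + mu R (j + 1) := by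
  obtain ⟨h1, δ, h4, h5⟩ := les (M := mm R) (LinearMap.ker (piMap R)).subtype (piMap R) mm_exact
    (Submodule.injective_subtype _) piMap_surj j
  rw [← len_EE_vec mm_kill j]
  refine len_exact _ δ ?_ ?_ h4
  · rw [injective_iff_map_eq_zero]
    intro x hx
    obtain ⟨y, rfl⟩ := (h1 x).1 hx
    exact hz j hj y
  · intro y
    exact (h5 y).1 (hz (j+1) (by omega) y)

include h2 h3 hz in
lemma N_zero : mu R 0 + len R (mm R) * mu R 0 
    = len R (mm R) + len R ↥(maximalIdeal R ^ 2) + mu R 1 := by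
  obtain ⟨h1, δ, h4, h5⟩ := les (M := mm R) (LinearMap.ker (piMap R)).subtype (piMap R) mm_exact
    (Submodule.injective_subtype _) piMap_surj 0
  have e1 := len_ker_range (pull (M := mm R) (N := R ⧸ maximalIdeal R ^ 2) (LinearMap.ker (piMap R)).subtype 0)
  have e2 := len_ker_range δ
  have hδ : LinearMap.range δ = ⊤ := LinearMap.range_eq_top.2 fun y => 
    (h5 y).1 (hz 1 le_rfl y)
  rw [LinearMap.exact_iff.1 h4, hδ, len_equiv Submodule.topEquiv] at e2
  rw [LinearMap.exact_iff.1 h1, 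
    ← len_equiv (LinearEquiv.ofInjective _ (pull_injective_of_surjective _ (piMap_surj (R := R)))),
    len_EE_0_quot, colon_m2 h3 h2, len_m] at e1
  change len R (EE R (mm R) 0) = _ at e2
  rw [len_EE_vec mm_kill] at e2
  change _ = mu R 0 + _ at e1
  change _ = _ + mu R 1 at e2
  change _ * mu R 0 = _ at e2
  omega

lemma m2_exact : Function.Exact (maximalIdeal R ^ 2).subtype (maximalIdeal R ^ 2).mkQ := by
  rw [LinearMap.exact_iff]; simp

include h2 h3 in
lemma N_one : len R ↥(maximalIdeal R ^ 2) * mu R 0 = len R (EE R (R ⧸ maximalIdeal R ^ 2) 1) + 1 := by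
  obtain ⟨h1, δ, h4, h5⟩ := les _ _ m2_exact (Submodule.injective_subtype _) 
    (Submodule.mkQ_surjective (maximalIdeal R ^ 2)) 0
  have e1 := len_ker_range (pull (maximalIdeal R ^ 2).subtype 0)
  have e2 := len_ker_range δ
  have _ := EE_free_subsingleton (R := R) (M := R) 0
  have hδ : LinearMap.range δ = ⊤ := LinearMap.range_eq_top.2 fun y => 
    (h5 y).1 (Subsingleton.elim _ _)
  rw [LinearMap.exact_iff.1 h4, hδ, len_equiv Submodule.topEquiv] at e2
  rw [LinearMap.exact_iff.1 h1, 
    ← len_equiv (LinearEquiv.ofInjective _ (pull_injective_of_surjective _ 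
      (Submodule.mkQ_surjective (maximalIdeal R ^ 2)))),
    len_EE_0_quot, colon_m2 h3 h2, len_m, len_equiv (EE0 R), 
    len_equiv (LinearMap.ringLmapEquivSelf R R R), len_R] at e1
  rw [len_EE_vec (m2_kill h3)] at e2
  change _ * mu R 0 = _ + len R (EE R (R ⧸ maximalIdeal R ^ 2) 1) at e2
  omega

include h3 in
lemma N_two (j : ℕ) (hj : 1 ≤ j) : 
    len R (EE R (R ⧸ maximalIdeal R ^ 2) (j + 1)) = len R ↥(maximalIdeal R ^ 2) * mu R j := by
  obtain ⟨h1, δ, h4, h5⟩ := les _ _ m2_exact (Submodule.injective_subtype _) 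
    (Submodule.mkQ_surjective (maximalIdeal R ^ 2)) j
  have s1 := EE_free_subsingleton (R := R) (M := R) j
  have s2 : Subsingleton (EE R R j) := by
    obtain ⟨i, rfl⟩ : ∃ i, j = i + 1 := ⟨j - 1, by omega⟩
    exact EE_free_subsingleton (R := R) (M := R) i
  rw [mu, ← len_EE_vec (m2_kill h3)]
  refine (len_equiv (LinearEquiv.ofBijective δ ⟨?_, fun y => (h5 y).1 (Subsingleton.elim _ _)⟩)).symm
  rw [injective_iff_map_eq_zero]
  intro x hx
  obtain ⟨y, rfl⟩ := (h4 x).1 hx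
  rw [Subsingleton.elim y 0, map_zero]

end main
end Kx

section Cx
set_option linter.unusedSectionVars false

lemma int_all (P : ℤ → Prop) (h0 : ∃ i, P i) (hup : ∀ i, P i → P (i + 1))
    (hdn : ∀ i, P (i + 1) → P i) (i : ℤ) : P i := by
  obtain ⟨k, hk⟩ := h0
  induction i using Int.inductionOn' (b := k) with
  | zero => exact hk
  | succ j _ hj => exact hup j hj
  | pred j _ hj => exact hdn (j - 1) (by rwa [sub_add_cancel])

lemma ideal_le_of_smul_top_le {R : Type} [CommRing R] {M : Type} [AddCommGroup M] [Module R M]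
    [Module.Free R M] [Nontrivial M] [Nontrivial R] (I J : Ideal R)
    (h : I • (⊤ : Submodule R M) ≤ J • ⊤) : I ≤ J := by
  let b := Module.Free.chooseBasis R M
  obtain ⟨k⟩ : Nonempty (Module.Free.ChooseBasisIndex R M) := b.index_nonempty
  intro a ha
  have h1 : a • b k ∈ J • (⊤ : Submodule R M) := h (Submodule.smul_mem_smul ha trivial)
  have h2 : b.coord k (a • b k) ∈ Submodule.map (b.coord k) (J • (⊤ : Submodule R M)) :=
    Submodule.mem_map_of_mem h1
  rw [Submodule.map_smul''] at h2
  have h3 := Submodule.smul_mono (le_refl J) (le_top : Submodule.map (b.coord k) ⊤ ≤ ⊤) h2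
  simpa using h3

lemma len_free {R : Type} [CommRing R] {M : Type} [AddCommGroup M] [Module R M]
    [Module.Free R M] [Module.Finite R M] [Nontrivial R] [IsArtinianRing R] [IsNoetherianRing R] :
    len R M = Module.finrank R M * len R R := by
  rw [len_equiv (Module.finBasis R M).equivFun, len_pi, Fintype.card_fin]

lemma subsingleton_of_top_le {R : Type} [CommRing R] [IsLocalRing R] {M : Type} [AddCommGroup M]
    [Module R M] [Module.Finite R M]
    (h : (⊤ : Submodule R M) ≤ maximalIdeal R • ⊤) : Subsingleton M := by
  have := Submodule.eq_bot_of_le_smul_of_le_jacobson_bot (maximalIdeal R) (⊤ : Submodule R M)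
    Module.Finite.fg_top h (IsLocalRing.maximalIdeal_le_jacobson _)
  exact (Submodule.subsingleton_iff R).1 (subsingleton_of_bot_eq_top this.symm)

variable {R : Type} [CommRing R] [IsNoetherianRing R] [IsLocalRing R]
    (h3 : maximalIdeal R ^ 3 = ⊥) (h2 : maximalIdeal R ^ 2 ≠ ⊥)
    {A : ℤ → Type} [∀ i, AddCommGroup (A i)] [∀ i, Module R (A i)]
    [hfree : ∀ i, Module.Free R (A i)] [hfin : ∀ i, Module.Finite R (A i)]
    (d : ∀ i : ℤ, A (i + 1) →ₗ[R] A i)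
    (hacyclic : ∀ i, LinearMap.range (d (i + 1)) = LinearMap.ker (d i))
    (hmin : ∀ i, LinearMap.range (d i) ≤ maximalIdeal R • (⊤ : Submodule R (A i)))

include hacyclic in
lemma z_exact (i : ℤ) : Function.Exact (LinearMap.range (d (i + 1))).subtype
    (d i).rangeRestrict := by
  rw [LinearMap.exact_iff]; simp [hacyclic i]

include hacyclic in
lemma ext_one (p : ℤ) (h : ∀ f : A (p + 1 + 1) →ₗ[R] R, f ∘ₗ d (p + 1 + 1) = 0 →
    ∃ g : A (p + 1) →ₗ[R] R, f = g ∘ₗ d (p + 1)) :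
    Subsingleton (EE R (LinearMap.range (d p)) 1) := by
  obtain ⟨h1, δ, h4, h5⟩ := les _ _ (z_exact d hacyclic p) (Submodule.injective_subtype _)
    (LinearMap.surjective_rangeRestrict _) 0
  have s1 := EE_free_subsingleton (R := R) (M := A (p + 1)) 0
  have hs : ∀ x, δ x = 0 := by
    intro x
    refine (h4 x).2 ?_
    obtain ⟨f, rfl⟩ := (EE0 (LinearMap.range (d (p + 1)))).symm.surjective x
    obtain ⟨g, hg⟩ := h (f ∘ₗ (d (p + 1)).rangeRestrict) (by
      apply LinearMap.ext
      intro y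
      have : (d (p + 1)).rangeRestrict (d (p + 1 + 1) y) = 0 := by
        apply Subtype.ext
        have : d (p + 1 + 1) y ∈ LinearMap.ker (d (p + 1)) := by
          rw [← hacyclic]; exact LinearMap.mem_range_self _ y
        simpa using this
      simp only [LinearMap.comp_apply, this, map_zero, LinearMap.zero_apply])
    refine ⟨(EE0 _).symm g, ?_⟩
    rw [pull_EE0_symm]
    congr 1
    apply LinearMap.ext
    intro z
    obtain ⟨y, rfl⟩ := (d (p + 1)).surjective_rangeRestrict z
    exact (LinearMap.congr_fun hg y).symm
  have h0 : ∀ y : EE R (LinearMap.range (d p)) 1, y = 0 := by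
    intro y
    obtain ⟨x, rfl⟩ := (h5 y).1 (Subsingleton.elim _ _)
    exact hs x
  exact ⟨fun x y => (h0 x).trans (h0 y).symm⟩

include hacyclic in
lemma ext_shift (i : ℤ) (j : ℕ) (h : Subsingleton (EE R (LinearMap.range (d (i + 1))) (j + 1))) :
    Subsingleton (EE R (LinearMap.range (d i)) (j + 1 + 1)) := by
  obtain ⟨h1, δ, h4, h5⟩ := les _ _ (z_exact d hacyclic i) (Submodule.injective_subtype _)
    (LinearMap.surjective_rangeRestrict _) (j + 1)
  have s1 := EE_free_subsingleton (R := R) (M := A (i + 1)) (j + 1)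
  have h0 : ∀ y : EE R (LinearMap.range (d i)) (j + 1 + 1), y = 0 := by
    intro y
    obtain ⟨x, rfl⟩ := (h5 y).1 (Subsingleton.elim _ _)
    rw [Subsingleton.elim x 0, map_zero]
  exact ⟨fun x y => (h0 x).trans (h0 y).symm⟩

include hacyclic in
lemma ext_all (p : ℤ) (h : Subsingleton (EE R (LinearMap.range (d p)) 1)) (j : ℕ) :
    ∀ i, i + j = p → Subsingleton (EE R (LinearMap.range (d i)) (j + 1)) := by
  induction j with
  | zero => intro i hi; obtain rfl : i = p := by simpa using hi
            exact h
  | succ j ih => intro i hi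
                 exact ext_shift d hacyclic i j (ih (i + 1) (by push_cast at hi; omega))

include hacyclic hmin in
lemma z_sub (i : ℤ) (h : d i = 0) : Subsingleton (A (i + 1)) := by
  apply subsingleton_of_top_le (R := R)
  refine le_trans ?_ (hmin (i + 1))
  rw [hacyclic, h]
  simp

include h3 hmin in
lemma kill3 (i : ℤ) (a : R) (ha : a ∈ maximalIdeal R ^ 2) (x : A i) 
    (hx : x ∈ LinearMap.range (d i)) : a • x = 0 := by
  have := Submodule.smul_mem_smul ha (hmin i hx)
  rw [← Submodule.mul_smul, ← pow_succ, h3] at this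
  simpa using this

include h2 h3 hacyclic hmin in
lemma a_nontrivial (hnz : ∃ i, Nontrivial (A i)) (i : ℤ) : Nontrivial (A i) := by
  refine int_all (fun i => Nontrivial (A i)) hnz ?_ ?_ i
  · intro i hi
    by_contra hn
    rw [not_nontrivial_iff_subsingleton] at hn
    obtain ⟨j, rfl⟩ : ∃ j, i = j + 1 := ⟨i - 1, by ring⟩
    apply h2
    rw [eq_bot_iff]
    apply ideal_le_of_smul_top_le (M := A (j + 1))
    rw [Submodule.smul_le]
    intro a ha x _
    have : a • x ∈ LinearMap.ker (d j) := by
      rw [LinearMap.mem_ker, map_smul]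
      exact kill3 h3 d hmin j a ha _ (LinearMap.mem_range_self _ _)
    rw [← hacyclic] at this
    obtain ⟨y, hy⟩ := this
    rw [← hy, Subsingleton.elim y 0, map_zero]
    exact zero_mem _
  · intro i hi
    by_contra hn
    rw [not_nontrivial_iff_subsingleton] at hn
    have := z_sub d hacyclic hmin i (by ext; exact Subsingleton.elim _ _)
    exact not_nontrivial _ hi

include hacyclic hmin in
lemma exists_gen (i : ℤ) (h : Nontrivial (A (i + 1))) :
    ∃ x : LinearMap.range (d i), x ∉ maximalIdeal R • (⊤ : Submodule R (LinearMap.range (d i))) := by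
  by_contra! hn
  have hs : Subsingleton (LinearMap.range (d i)) := subsingleton_of_top_le (R := R) fun x _ => hn x
  have := z_sub d hacyclic hmin i (by
    apply LinearMap.ext
    intro x
    have := congrArg Subtype.val (Subsingleton.elim ((d i).rangeRestrict x) 0)
    simpa using this)
  exact not_nontrivial _ h

include hmin in
lemma soc_kill (i : ℤ) (a : R) (ha : a ∈ socle R) (x : A i) 
    (hx : x ∈ LinearMap.range (d i)) : a • x = 0 := by
  have h : socle R • maximalIdeal R ≤ ⊥ := by
    rw [Submodule.smul_le]
    intro a ha b hb
    exact Submodule.mem_colon.1 ha b hb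
  have := Submodule.smul_mem_smul ha (hmin i hx)
  rw [← Submodule.mul_smul] at this
  have h' := Submodule.smul_mono_left h this
  simpa using h'

include h3 in
lemma m2_le_soc : maximalIdeal R ^ 2 ≤ socle R := by
  intro a ha
  refine Submodule.mem_colon.2 fun b hb => ?_
  rw [← h3, pow_succ]
  exact Ideal.mul_mem_mul ha hb

include hacyclic hmin in
lemma soc_le (i : ℤ) (hx : ∀ x : LinearMap.range (d i), (∀ a ∈ maximalIdeal R, a • x = 0) →
      x ∈ maximalIdeal R • (⊤ : Submodule R (LinearMap.range (d i)))) :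
    socle R • (⊤ : Submodule R (A i)) ≤ maximalIdeal R • LinearMap.range (d i) := by
  obtain ⟨i, rfl⟩ : ∃ j, i = j + 1 := ⟨i - 1, by ring⟩
  rw [Submodule.smul_le]
  intro a ha y _
  have hk : a • y ∈ LinearMap.range (d (i + 1)) := by
    rw [hacyclic, LinearMap.mem_ker, map_smul]
    exact soc_kill d hmin i a ha _ (LinearMap.mem_range_self _ _)
  have h1 := hx ⟨a • y, hk⟩ (by
    intro b hb
    apply Subtype.ext
    change b • a • y = 0
    have : b * a = 0 := by
      have := Submodule.mem_colon.1 ha b hb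
      rw [mul_comm]
      simpa using this
    rw [smul_smul, this, zero_smul])
  have h2 := Submodule.mem_map_of_mem (f := (LinearMap.range (d (i + 1))).subtype) h1
  rw [Submodule.map_smul'', Submodule.map_subtype_top] at h2
  exact h2

include hmin in
lemma mz_le (i : ℤ) : maximalIdeal R • LinearMap.range (d i) ≤ 
    maximalIdeal R ^ 2 • (⊤ : Submodule R (A i)) := by
  rw [pow_two, Submodule.mul_smul]
  exact Submodule.smul_mono le_rfl (hmin i)

variable [IsArtinianRing R]

include hacyclic in
lemma z_len (i : ℤ) : len R (LinearMap.range (d i)) + len R (LinearMap.range (d (i + 1))) 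
    = Module.finrank R (A (i + 1)) * len R R := by
  rw [← len_free, len_ker_range (d i), hacyclic, add_comm]

include hacyclic hmin in
lemma mz_len (i : ℤ) : len R ↥(maximalIdeal R • LinearMap.range (d i)) 
      + len R (LinearMap.range (d (i + 1))) 
    = Module.finrank R (A (i + 1)) * len R (maximalIdeal R) := by
  rw [← len_smul_top, len_ker_range (d i ∘ₗ (maximalIdeal R • (⊤ : Submodule R (A (i + 1)))).subtype)]
  rw [LinearMap.range_comp, Submodule.range_subtype, Submodule.map_smul'', Submodule.map_top,
    LinearMap.ker_comp, add_comm]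
  congr 1
  rw [← hacyclic]
  exact (len_equiv (Submodule.comapSubtypeEquivOfLe (hmin (i + 1)))).symm

end Cx

section Fin

lemma mu_pos_num (m q : ℕ → ℕ) (e s : ℕ) (he : 1 ≤ e) (hs : 1 ≤ s) (hs' : s ≤ m 0) (hr : 2 ≤ m 0)
    (n0 : m 0 + e * m 0 = e + s + m 1)
    (ng : ∀ j, 1 ≤ j → e * m j = q j + m (j + 1))
    (nt : ∀ j, 1 ≤ j → q (j + 1) = s * m j) (j : ℕ) : 0 < m (j + 1) := by
  induction j with
  | zero =>
    have : e * 2 ≤ e * m 0 := Nat.mul_le_mul_left e hr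
    change 0 < m 1
    omega
  | succ j ih =>
    by_contra hn
    have h0 : m (j + 2) = 0 := by change ¬ 0 < m (j + 2) at hn; omega
    have h1 := ng (j + 2) (by omega)
    have h2 := nt (j + 1) (by omega)
    rw [h0] at h1
    have h4 : 0 < s * m (j + 1) := Nat.mul_pos hs ih
    change q (j + 2) = _ at h2
    omega

lemma final_num (m q : ℕ → ℕ) (r : ℕ) (h0 : m 0 = r)
    (n0 : m 0 + (r + 1) * m 0 = (r + 1) + r + m 1)
    (n1 : r * m 0 = q 1 + 1)
    (ng : ∀ j, 1 ≤ j → (r + 1) * m j = q j + m (j + 1))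
    (nt : ∀ j, 1 ≤ j → q (j + 1) = r * m j) (j : ℕ) :
    (m (j + 1) : ℤ) = r ^ j * (r ^ 2 - 1) ∧ (m (j + 2) : ℤ) = r ^ (j + 1) * (r ^ 2 - 1) := by
  induction j with
  | zero =>
    have a := ng 1 le_rfl
    rw [h0] at n0 n1
    zify at a n0 n1
    simp only [zero_add] at *
    have b : (m 1 : ℤ) = r ^ 2 - 1 := by linarith
    refine ⟨by rw [b]; ring, ?_⟩
    rw [b] at a
    change _ = _ + (m 2 : ℤ) at a
    linarith
  | succ j ih =>
    refine ⟨ih.2, ?_⟩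
    have a := ng (j + 2) (by omega)
    have b := nt (j + 1) (by omega)
    zify at a b
    change _ = _ + (m (j + 1 + 2) : ℤ) at a
    change (q (j + 2) : ℤ) = _ at b
    rw [b, ih.1, ih.2] at a
    have : (m (j + 1 + 2) : ℤ) = (r + 1) * (r ^ (j + 1) * (r ^ 2 - 1)) - r * (r ^ j * (r ^ 2 - 1)) := by
      linarith
    rw [this]
    ring

variable {R : Type} [CommRing R] [IsNoetherianRing R] [IsLocalRing R] [IsArtinianRing R]

lemma bassNum_eq (i : ℕ) : bassNum R i = (mu R i : ℕ∞) := by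
  rw [bassNum, length_extModule, mu, coe_len]

lemma socdim_eq : socdim R = (len R (socle R) : ℕ∞) := by
  rw [socdim, moduleLength_eq, coe_len]

lemma mu_zero : mu R 0 = len R (socle R) := len_EE_0_quot (maximalIdeal R)

end Fin

/-- Theorem A(d): let `(R, m, k)` be a local ring with `m³ = 0 ≠ m²` which is not
Gorenstein (equivalently, `r ≥ 2`).  Suppose there exists a non-zero minimal acyclic
complex `A` (with differentials `d i : A (i+1) → A i`) of finitely generated free
`R`-modules such that moreover `H_n(A*) = 0` for some integer `n`, where
`A* = Hom_R(A, R)`.  Then `μ⁰_R = r` and `μ^i_R = r^{i−1}·(r² − 1)` for all `i ≥ 1`,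
i.e. the Bass series of `R` is `(r − t)/(1 − r·t)`. -/
theorem bass_series (R : Type) [CommRing R] [IsNoetherianRing R] [IsLocalRing R]
    (h3 : maximalIdeal R ^ 3 = ⊥) (h2 : maximalIdeal R ^ 2 ≠ ⊥)
    (hnotGor : 2 ≤ socdim R)
    (A : ℤ → Type) [∀ i, AddCommGroup (A i)] [∀ i, Module R (A i)]
    (hfree : ∀ i, Module.Free R (A i)) (hfin : ∀ i, Module.Finite R (A i))
    (d : ∀ i : ℤ, A (i + 1) →ₗ[R] A i)
    (hcx : ∀ i, d i ∘ₗ d (i + 1) = 0)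
    (hacyclic : ∀ i, LinearMap.range (d (i + 1)) = LinearMap.ker (d i))
    (hmin : ∀ i, LinearMap.range (d i) ≤ maximalIdeal R • (⊤ : Submodule R (A i)))
    (hnz : ∃ i, Nontrivial (A i))
    (hdual : ∃ n : ℤ, dualHomologyIsZero R A d n) :
    bassNum R 0 = socdim R ∧
    ∀ i : ℕ, 1 ≤ i → bassNum R i = socdim R ^ (i - 1) * (socdim R ^ 2 - 1) := by
  have art : IsArtinianRing R :=
    (isArtinianRing_iff_isNilpotent_maximalIdeal R).2 ⟨3, h3⟩
  have hnt := a_nontrivial h3 h2 d hacyclic hmin hnz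
  -- vanishing of Ext
  obtain ⟨p, hp⟩ : ∃ p : ℤ, Subsingleton (EE R (LinearMap.range (d p)) 1) := by
    obtain ⟨n, hn⟩ := hdual
    unfold dualHomologyIsZero at hn
    obtain ⟨p, hp⟩ : ∃ p, n - 1 = p + 1 := ⟨n - 2, by ring⟩
    rw [hp] at hn
    exact ⟨p, ext_one d hacyclic p hn⟩
  have hext := ext_all d hacyclic p hp
  have hz : ∀ n, 1 ≤ n → ∀ y : EE R (ResidueField R) n, pull (piMap R) n y = 0 := by
    intro n hn y
    obtain ⟨j, rfl⟩ : ∃ j, n = j + 1 := ⟨n - 1, by omega⟩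
    have := hext j (p - j) (by ring)
    obtain ⟨x, hx⟩ := exists_gen d hacyclic hmin (p - j) (hnt _)
    exact pull_piMap_zero x hx
      (fun a ha => Subtype.ext (kill3 h3 d hmin _ a ha _ x.2)) (j + 1) y
  have n0 := N_zero h3 h2 hz
  have n1 := N_one (R := R) h3 h2
  have ng := N_gen hz
  have nt := N_two (R := R) h3
  have hr : 2 ≤ len R (socle R) := by
    rw [socdim_eq] at hnotGor
    exact_mod_cast hnotGor
  have hs : 1 ≤ len R ↥(maximalIdeal R ^ 2) := by
    rw [Nat.one_le_iff_ne_zero, Ne, len_eq_zero, Submodule.subsingleton_iff_eq_bot]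
    exact h2
  have hs' : len R ↥(maximalIdeal R ^ 2) ≤ len R (socle R) := by
    rw [len_exact (Submodule.inclusion (m2_le_soc h3)) (LinearMap.range (Submodule.inclusion (m2_le_soc h3))).mkQ
      (Submodule.inclusion_injective _) (Submodule.mkQ_surjective _)
      (by rw [LinearMap.exact_iff]; simp)]
    omega
  have he : 1 ≤ len R (mm R) := by
    rw [Nat.one_le_iff_ne_zero]
    intro h0
    have e1 := len_k (R := R)
    have e2 := mm_kill (R := R)
    rw [len_eq_zero] at h0
    have hle : maximalIdeal R ≤ maximalIdeal R ^ 2 := by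
      intro x hx
      have h1 : (Submodule.Quotient.mk x : R ⧸ maximalIdeal R ^ 2) ∈ LinearMap.ker (piMap R) := by
        rw [LinearMap.mem_ker, piMap_mk]
        exact (residue_eq_zero_iff x).2 hx
      have h4 := congrArg Subtype.val (Subsingleton.elim (⟨_, h1⟩ : mm R) 0)
      exact (Submodule.Quotient.mk_eq_zero _).1 h4
    apply h2
    have h4 : maximalIdeal R ^ 2 ≤ maximalIdeal R ^ 3 := by
      rw [pow_succ _ 2, pow_two]
      exact Ideal.mul_mono (by rw [← pow_two]; exact hle) le_rfl
    rw [h3] at h4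
    exact le_bot_iff.1 h4
  have hpos := mu_pos_num (mu R) (fun j => len R (EE R (R ⧸ maximalIdeal R ^ 2) j))
    (len R (mm R)) (len R ↥(maximalIdeal R ^ 2)) he hs (by rw [mu_zero]; exact hs')
    (by rw [mu_zero]; exact hr) n0 ng nt
  have hxs : ∀ i, i ≤ p → ∀ x : LinearMap.range (d i), (∀ a ∈ maximalIdeal R, a • x = 0) →
      x ∈ maximalIdeal R • (⊤ : Submodule R (LinearMap.range (d i))) := by
    intro i hi x hx
    by_contra hn
    obtain ⟨j, hj⟩ := Int.le.dest hi
    have := hext j i hj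
    have h0 := EE_k_subsingleton x hn hx (j + 1)
    have := hpos j
    rw [mu, len_eq_zero.2 h0] at this
    exact lt_irrefl _ this
  have hsoc : socle R = maximalIdeal R ^ 2 := by
    refine le_antisymm ?_ (m2_le_soc h3)
    have := hnt p
    exact ideal_le_of_smul_top_le (M := A p) _ _
      ((soc_le d hacyclic hmin p (hxs p le_rfl)).trans (mz_le d hmin p))
  have hmz : ∀ i, i ≤ p → maximalIdeal R • LinearMap.range (d i) =
      maximalIdeal R ^ 2 • (⊤ : Submodule R (A i)) := by
    intro i hi
    refine le_antisymm (mz_le d hmin i) ?_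
    rw [← hsoc]
    exact soc_le d hacyclic hmin i (hxs i hi)
  have hmu0 := mu_zero (R := R)
  rw [hsoc] at hr hmu0
  have hb : ∀ i, i + 1 ≤ p → len R (mm R) * Module.finrank R (A (i + 1)) =
      Module.finrank R (A (i + 1 + 1)) + len R ↥(maximalIdeal R ^ 2) * Module.finrank R (A i) := by
    intro i hi
    have a1 := mz_len d hacyclic hmin i
    have a2 := mz_len d hacyclic hmin (i + 1)
    have a3 := z_len d hacyclic (i + 1)
    rw [hmz i (by omega), len_smul_top, len_m] at a1
    rw [hmz (i + 1) hi, len_smul_top, len_m] at a2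
    rw [len_R] at a3
    zify at *
    linarith
  have hes : len R (mm R) = len R ↥(maximalIdeal R ^ 2) + 1 := by
    refine numeric_seq (fun j => Module.finrank R (A (p + 1 - j))) _ _ hr ?_ ?_
    · intro j
      have := hnt (p + 1 - j)
      refine Nat.pos_of_ne_zero fun h0 => ?_
      have h1 : len R (A (p + 1 - j)) = 0 := by rw [len_free, h0, zero_mul]
      rw [len_eq_zero] at h1
      exact not_nontrivial _ this
    · intro j
      have key := hb (p - 1 - j) (by omega)
      have i1 : p + 1 - ((j + 1 : ℕ) : ℤ) = p - 1 - j + 1 := by push_cast; ring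
      have i2 : p + 1 - (j : ℤ) = p - 1 - j + 1 + 1 := by ring
      have i3 : p + 1 - ((j + 2 : ℕ) : ℤ) = p - 1 - j := by push_cast; ring
      beta_reduce
      rw [i1, i2, i3]
      exact key
  rw [hes] at n0 ng
  have fin := final_num (mu R) (fun j => len R (EE R (R ⧸ maximalIdeal R ^ 2) j))
    (len R ↥(maximalIdeal R ^ 2)) hmu0 n0 n1 ng nt
  refine ⟨by rw [bassNum_eq, socdim_eq, mu_zero], ?_⟩
  intro i hi
  obtain ⟨j, rfl⟩ : ∃ j, i = j + 1 := ⟨i - 1, by omega⟩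
  have f1 := (fin j).1
  rw [bassNum_eq, socdim_eq, hsoc, Nat.add_sub_cancel]
  generalize len R ↥(maximalIdeal R ^ 2) = r at f1 hr
  have f2 : mu R (j + 1) = r ^ j * (r ^ 2 - 1) := by
    have : 1 ≤ r ^ 2 := Nat.one_le_pow _ _ (by omega)
    zify [this]
    exact f1
  rw [f2]
  push_cast
  rfl
end

section
/- (Theorem B) Assume R is not Gorenstein (equivalently, r ≥ 2), and let A be a non-zero minimal acyclic complex of finitely generated free R-modules. Then exactly one of the following holds: (I) the residue field k is not a direct summand of Coker ∂_i for any i ∈ ℤ, and there is a positive integer a such that rank_R A_i = a for all i ∈ ℤ and ℓ_R(Coker ∂_i) = a·e for all i ∈ ℤ; or (II) there is an integer κ such that k is a direct summand of Coker ∂_{κ+2} but not of Coker ∂_{i+2} for any i < κ, and there is a positive integer a such that rank_R A_i = a for all i ≤ κ, rank_R A_{i+1} > rank_R A_i for all i ≥ κ, and ℓ_R(Coker ∂_{i+2}) = a·e for all i ≤ κ. -/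
open IsLocalRing CategoryTheory

namespace TB

lemma exists_min (a : ℤ → ℤ) (ha : ∀ i, 0 < a i) (K : ℤ) : ∃ i0 ≤ K, ∀ i ≤ K, a i0 ≤ a i := by
  obtain ⟨v, ⟨i0, h0, rfl⟩, hv⟩ := Int.exists_least_of_bdd (P := fun v => ∃ i ≤ K, a i = v)
    ⟨0, by rintro z ⟨i, _, rfl⟩; exact (ha i).le⟩ ⟨a K, K, le_rfl, rfl⟩
  exact ⟨i0, h0, fun i hi => hv _ ⟨i, hi, rfl⟩⟩

lemma int_root (b c e f : ℤ) (hc : 0 < c) (h : b ^ 2 = c * (e * b - f * c)) : c ∣ b := by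
  obtain ⟨g, c', b', hg, hco, rfl, rfl⟩ := Int.exists_gcd_one' (m := c) (n := b) (Int.gcd_pos_of_ne_zero_left _ hc.ne')
  have hg0 : (g : ℤ) ≠ 0 := by exact_mod_cast hg.ne'
  have h2 : b' ^ 2 = c' * (e * b' - f * c') := by
    apply mul_right_cancel₀ (pow_ne_zero 2 hg0)
    linear_combination h
  have h3 : c' ∣ b' ^ 2 := ⟨_, h2⟩
  have hco' : IsCoprime c' b' := Int.isCoprime_iff_gcd_eq_one.mpr hco
  have h4 : IsUnit c' := (hco'.pow_right (n := 2)).isUnit_of_dvd' (dvd_refl _) h3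
  exact mul_dvd_mul_right (h4.dvd) _

lemma up_ind (K : ℤ) (P : ℤ → Prop) (i0 : ℤ) (h0 : ∀ i ≤ i0, P i)
    (hs : ∀ i, i0 ≤ i → i < K → P i → P (i + 1)) : ∀ i ≤ K, P i := by
  intro i hi
  by_cases h : i ≤ i0
  · exact h0 i h
  · push Not at h
    have : ∀ n : ℕ, i0 + n ≤ K → P (i0 + n) := by
      intro n
      induction n with
      | zero => intro _; simpa using h0 i0 le_rfl
      | succ n ih =>
        intro hn
        push_cast at hn ⊢
        rw [← add_assoc]
        exact hs _ (by omega) (by omega) (ih (by omega))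
    have h1 := this (i - i0).toNat
    rw [Int.toNat_of_nonneg (by omega)] at h1
    simpa using h1 (by omega)

lemma rec_const (a : ℤ → ℤ) (ha : ∀ i, 0 < a i) (e f K : ℤ) (hf : 2 ≤ f)
    (hrec : ∀ i, i + 1 < K → a (i + 2) = e * a (i + 1) - f * a i) :
    e = f + 1 ∧ ∀ i ≤ K, a i = a K := by
  have hD : ∀ i, i + 2 < K → a (i + 2) ^ 2 - a (i + 1) * a (i + 3) =
      f * (a (i + 1) ^ 2 - a i * a (i + 2)) := by
    intro i hi
    have h1 := hrec i (by omega)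
    have h2 := hrec (i + 1) (by omega)
    rw [show i + 1 + 2 = i + 3 by ring, show i + 1 + 1 = i + 2 by ring] at h2
    rw [h2]
    linear_combination a (i + 2) * h1
  have hdvd : ∀ n : ℕ, ∀ i, i + 1 < K → f ^ n ∣ a (i + 1) ^ 2 - a i * a (i + 2) := by
    intro n
    induction n with
    | zero => intro i _; simp
    | succ n ih =>
      intro i hi
      have h1 := hD (i - 1) (by omega)
      have h2 := ih (i - 1) (by omega)
      rw [show i - 1 + 2 = i + 1 by ring, show i - 1 + 3 = i + 2 by ring, show i - 1 + 1 = i by ring] at h1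
      rw [show i - 1 + 2 = i + 1 by ring, show i - 1 + 1 = i by ring] at h2
      rw [h1, pow_succ']
      exact mul_dvd_mul_left _ h2
  have hD0 : ∀ i, i + 1 < K → a (i + 1) ^ 2 - a i * a (i + 2) = 0 := by
    intro i hi
    by_contra hne
    set D := a (i + 1) ^ 2 - a i * a (i + 2) with hDd
    have h1 := hdvd D.natAbs i hi
    have h2 := Int.natAbs_dvd_natAbs.mpr h1
    have h3 := Nat.le_of_dvd (Int.natAbs_pos.mpr hne) h2
    rw [Int.natAbs_pow] at h3
    have h4 : D.natAbs < f.natAbs ^ D.natAbs := Nat.lt_pow_self (by omega)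
    omega
  have hmono : ∀ i, i + 1 < K → a i ≤ a (i + 1) := by
    intro i hi
    have h1 := hD0 i hi
    have h2 := hrec i hi
    apply Int.le_of_dvd (ha _)
    apply int_root _ _ e f (ha i)
    rw [h2] at h1
    linear_combination h1
  obtain ⟨i0, h0, hmin⟩ := exists_min a ha (K - 1)
  have hdown : ∀ n : ℕ, a (i0 - n) ≤ a i0 := by
    intro n
    induction n with
    | zero => simp
    | succ n ih =>
      have := hmono (i0 - (n + 1 : ℕ)) (by push_cast; omega)
      rw [show i0 - ((n + 1 : ℕ) : ℤ) + 1 = i0 - n by push_cast; ring] at this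
      omega
  have hconst : ∀ i ≤ i0, a i = a i0 := by
    intro i hi
    have h1 := hdown (i0 - i).toNat
    rw [Int.toNat_of_nonneg (by omega), sub_sub_cancel] at h1
    exact le_antisymm h1 (hmin i (by omega))
  have he : e = f + 1 := by
    have h1 := hrec (i0 - 2) (by omega)
    rw [hconst (i0 - 2) (by omega), hconst (i0 - 2 + 1) (by omega), hconst (i0 - 2 + 2) (by omega)] at h1
    have := ha i0
    apply mul_right_cancel₀ this.ne'
    linear_combination -h1
  refine ⟨he, ?_⟩
  have hall : ∀ i ≤ K, a i = a i0 ∧ a (i - 1) = a i0 := by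
    refine up_ind K (fun i => a i = a i0 ∧ a (i - 1) = a i0) i0 ?_ ?_
    · intro i hi; exact ⟨hconst i hi, hconst _ (by omega)⟩
    · rintro i hi hiK ⟨h1, h2⟩
      have h3 := hrec (i - 1) (by omega)
      rw [show i - 1 + 2 = i + 1 by ring, show i - 1 + 1 = i by ring, h1, h2, he] at h3
      refine ⟨by rw [h3]; ring, by simpa using h1⟩
  intro i hi
  rw [(hall i hi).1, (hall K le_rfl).1]

lemma numeric (a z q : ℤ → ℤ) (e f r : ℤ) (hf : 1 ≤ f) (hr : 2 ≤ r) (hrf : f ≤ r) (hre : r < e + f)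
    (hane : ∃ i, a i ≠ 0) (ha0 : ∀ i, 0 ≤ a i) (hq : ∀ i, 0 ≤ q i)
    (n1 : ∀ i, z i + z (i + 1) = (1 + e + f) * a (i + 1))
    (n2 : ∀ i, (e + f) * a (i + 1) + q i = r * a i + z (i + 1))
    (n3 : ∀ i, f * a (i + 1) + e * q i ≤ z (i + 1))
    (n4 : ∀ i, (e + f) * a (i + 1) ≤ f * a i + z (i + 1))
    (n5 : ∀ i, f * a i ≤ z i) (n6 : ∀ i, z i ≤ (e + f) * a i)
    (gr : f + 1 ≤ e → ∀ j, 0 < q j → ∀ n : ℕ, (n : ℤ) + 1 ≤ a (j + 1 + n)) :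
    (∀ i, 0 < a i) ∧
    (((∀ i, q i = 0) ∧ (∀ i, a i = a 0) ∧ ∀ i, z i = a 0 * e) ∨
     ∃ κ, 0 < q κ ∧ (∀ i < κ, q i = 0) ∧ (∀ i ≤ κ, a i = a κ) ∧ (∀ i, κ ≤ i → a i < a (i + 1)) ∧
      ∀ i ≤ κ, z i = a κ * e) := by
  have he1 : 1 ≤ e := by omega
  have hpos : ∀ i, 0 < a i := by
    have hdn : ∀ i, a i = 0 → a (i - 1) = 0 := by
      intro i hi
      have h1 := n1 (i - 1)
      rw [sub_add_cancel, hi] at h1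
      have h2 := n5 i
      have h3 := n5 (i - 1)
      have := ha0 (i - 1)
      rw [hi] at h2
      nlinarith
    have hup : ∀ i, a i = 0 → a (i + 1) = 0 := by
      intro i hi
      have h1 := n1 i
      have h2 := n5 i
      have h3 := n6 i
      have h4 := n6 (i + 1)
      have := ha0 (i + 1)
      rw [hi] at h2 h3
      nlinarith
    by_contra hcon
    push Not at hcon
    obtain ⟨j, hj⟩ := hcon
    have hj0 : a j = 0 := le_antisymm hj (ha0 j)
    obtain ⟨i, hi⟩ := hane
    apply hi
    have h1 : ∀ n : ℕ, a (j - n) = 0 := by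
      intro n
      induction n with
      | zero => simpa using hj0
      | succ n ih =>
        have := hdn _ ih
        rwa [show j - (n : ℤ) - 1 = j - ((n + 1 : ℕ) : ℤ) by push_cast; ring] at this
    have h2 : ∀ n : ℕ, a (j + n) = 0 := by
      intro n
      induction n with
      | zero => simpa using hj0
      | succ n ih =>
        have := hup _ ih
        rwa [show j + (n : ℤ) + 1 = j + ((n + 1 : ℕ) : ℤ) by push_cast; ring] at this
    rcases le_total i j with h | h
    · have := h1 (j - i).toNat
      rwa [Int.toNat_of_nonneg (by omega), sub_sub_cancel] at this
    · have := h2 (i - j).toNat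
      rwa [Int.toNat_of_nonneg (by omega), add_sub_cancel] at this
  refine ⟨hpos, ?_⟩
  -- r = f
  have hr_eq : r = f := by
    by_contra hne
    have hlt : f + 1 ≤ r := by omega
    have he2 : 2 ≤ e := by omega
    obtain ⟨i0, _, hmin⟩ := exists_min a hpos 0
    have h := hmin (i0 - 2) (by omega)
    have h1 : a (i0 - 2) ≤ q (i0 - 2) := by
      have h2 := n2 (i0 - 2)
      have h4 := n4 (i0 - 2)
      have := hpos (i0 - 2)
      nlinarith
    have h3 := n3 (i0 - 2)
    have h5 := n4 (i0 - 1)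
    have h6 := n1 (i0 - 1)
    rw [show i0 - 2 + 1 = i0 - 1 by ring] at h3
    rw [show i0 - 1 + 1 = i0 by ring] at h5 h6
    have := hpos (i0 - 2)
    have := hpos i0
    nlinarith
  subst hr_eq
  -- recurrence
  have rc : ∀ i, a (i + 2) = e * a (i + 1) - r * a i + q i + q (i + 1) := by
    intro i
    have h1 := n2 i
    have h2 := n2 (i + 1)
    have h3 := n1 (i + 1)
    have h4 := n1 i
    rw [show i + 1 + 1 = i + 2 by ring] at h2 h3
    linarith
  have hq1 : ∀ i, r * a i + (e - 1) * q i ≤ e * a (i + 1) := by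
    intro i
    have h1 := n2 i
    have h2 := n3 i
    linarith
  have hle : r + 1 ≤ e := by
    by_contra hcon
    have hre' : e ≤ r := by omega
    have hmono : ∀ i, a i ≤ a (i + 1) := by
      intro i
      have h1 := hq1 i
      have h2 := hq i
      have h3 := hpos i
      by_contra hlt
      push Not at hlt
      nlinarith [mul_nonneg (by omega : 0 ≤ e - 1) h2]
    obtain ⟨i0, _, hmin⟩ := exists_min a hpos 0
    have e1 := hmono (i0 - 1)
    have e2 := hmono (i0 - 2)
    have e3 := hmono (i0 - 3)
    rw [show i0 - 1 + 1 = i0 by ring] at e1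
    rw [show i0 - 2 + 1 = i0 - 1 by ring] at e2
    rw [show i0 - 3 + 1 = i0 - 2 by ring] at e3
    have f1 := hmin (i0 - 1) (by omega)
    have f2 := hmin (i0 - 2) (by omega)
    have f3 := hmin (i0 - 3) (by omega)
    have g1 : a (i0 - 1) = a i0 := by omega
    have g2 : a (i0 - 2) = a i0 := by omega
    have g3 : a (i0 - 3) = a i0 := by omega
    have k1 := hq1 (i0 - 2)
    have k2 := hq1 (i0 - 3)
    rw [show i0 - 2 + 1 = i0 - 1 by ring, g1, g2] at k1
    rw [show i0 - 3 + 1 = i0 - 2 by ring, g2, g3] at k2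
    have k3 := rc (i0 - 3)
    rw [show i0 - 3 + 2 = i0 - 1 by ring, show i0 - 3 + 1 = i0 - 2 by ring, g1, g2, g3] at k3
    have p1 := hq (i0 - 2)
    have p2 := hq (i0 - 3)
    have p := hpos i0
    have hee : e = r := by
      by_contra hne
      have : e + 1 ≤ r := by omega
      nlinarith [mul_nonneg (by omega : 0 ≤ e - 1) p1]
    subst hee
    have q1 : q (i0 - 2) = 0 := by nlinarith
    have q2 : q (i0 - 3) = 0 := by nlinarith
    rw [q1, q2] at k3
    linarith
  have grow := gr hle
  have hrec : ∀ K, (∀ i < K, q i = 0) → e = r + 1 ∧ ∀ i ≤ K, a i = a K := by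
    intro K hK
    apply rec_const a hpos e r K (by omega)
    intro i hi
    rw [rc i, hK i (by omega), hK (i + 1) (by omega)]; ring
  have hz : ∀ i, q i = 0 → z i = r * a i + a (i + 1) := by
    intro i hi
    have h1 := n1 i
    have h2 := n2 i
    rw [hi] at h2
    linarith
  by_cases hall : ∀ i, q i = 0
  · left
    refine ⟨hall, ?_⟩
    have hc : ∀ i, a i = a 0 := by
      intro i
      have h1 := (hrec (max i 0) (fun j _ => hall j)).2
      rw [h1 i (le_max_left _ _), h1 0 (le_max_right _ _)]
    refine ⟨hc, fun i => ?_⟩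
    rw [hz i (hall i), hc i, hc (i + 1), (hrec 0 (fun j _ => hall j)).1]; ring
  · right
    push Not at hall
    obtain ⟨j0, hj0⟩ := hall
    obtain ⟨κ, hκ, hκmin⟩ := Int.exists_least_of_bdd (P := fun j => 0 < q j)
      ⟨min 0 (- a 0), by
        intro j hj
        by_contra hlt
        push Not at hlt
        have h1 := grow j hj (-1 - j).toNat
        rw [Int.toNat_of_nonneg (by omega)] at h1
        rw [show j + 1 + (-1 - j) = 0 by ring] at h1
        omega⟩ ⟨j0, lt_of_le_of_ne (hq j0) (Ne.symm hj0)⟩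
    have hlt : ∀ i < κ, q i = 0 := by
      intro i hi
      by_contra hne
      have := hκmin i (lt_of_le_of_ne (hq i) (Ne.symm hne))
      omega
    obtain ⟨hee, hconst⟩ := hrec κ hlt
    have hzc : ∀ i < κ, z i = a κ * e := by
      intro i hi
      rw [hz i (hlt i hi), hconst i hi.le, hconst (i + 1) (by omega), hee]; ring
    refine ⟨κ, hκ, hlt, hconst, ?_, ?_⟩
    · have hn : ∀ n : ℕ, a (κ + n) < a (κ + n + 1) := by
        intro n
        induction n with
        | zero =>
          have h1 := rc (κ - 1)
          rw [show κ - 1 + 2 = κ + 1 by ring, show κ - 1 + 1 = κ by ring, hconst (κ - 1) (by omega),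
            hlt (κ - 1) (by omega), hee] at h1
          simp only [Nat.cast_zero, add_zero]
          linarith
        | succ n ih =>
          have h1 := rc (κ + n)
          push_cast
          rw [show κ + ((n : ℤ) + 1) + 1 = κ + n + 2 by ring, h1, ← add_assoc, hee]
          have := hq (κ + n)
          have := hq (κ + n + 1)
          nlinarith
      intro i hi
      have := hn (i - κ).toNat
      rwa [Int.toNat_of_nonneg (by omega), add_sub_cancel] at this
    · intro i hi
      rcases lt_or_eq_of_le hi with h | rfl
      · exact hzc i h
      · have h1 := n1 (i - 1)
        rw [sub_add_cancel, hzc (i - 1) (by omega)] at h1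
        rw [hee] at h1 ⊢
        linarith
end TB
namespace TB
set_option linter.unusedSectionVars false
set_option linter.style.haveILetI false

lemma moduleLength_eq (R M : Type) [Ring R] [AddCommGroup M] [Module R M] :
    moduleLength R M = Module.length R M := by
  apply WithBot.coe_injective
  rw [Module.coe_length, Order.krullDim, moduleLength]
  rw [WithBot.coe_iSup (OrderTop.bddAbove _)]
  rfl

/-- natural-number length -/
noncomputable def ln (R : Type) {M : Type} [Ring R] [AddCommGroup M] [Module R M]
    (N : Submodule R M) : ℕ := (Module.length R N).toNat

section
variable {R : Type} [CommRing R] [IsArtinianRing R]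
variable {M N : Type} [AddCommGroup M] [Module R M] [Module.Finite R M]
  [AddCommGroup N] [Module R N] [Module.Finite R N]

lemma coe_ln (P : Submodule R M) : (ln R P : ℕ∞) = Module.length R P := by
  rw [ln, ENat.natCast_toNat]
  exact Module.length_ne_top

lemma ln_add (g : M →ₗ[R] N) : ln R (LinearMap.range g) + ln R (LinearMap.ker g) = ln R (⊤ : Submodule R M) := by
  have := Module.length_eq_add_of_exact (LinearMap.ker g).subtype g.rangeRestrict
    (Submodule.injective_subtype _) (g.surjective_rangeRestrict) (by
      intro x
      simp [LinearMap.rangeRestrict, Subtype.ext_iff])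
  rw [← ENat.natCast_inj]
  push_cast
  rw [coe_ln, coe_ln, coe_ln, Module.length_top, this, add_comm]

lemma ln_mono {P Q : Submodule R M} (h : P ≤ Q) : ln R P ≤ ln R Q := by
  rw [← ENat.natCast_le_natCast, coe_ln, coe_ln, Module.length_submodule, Module.length_submodule]
  exact Order.height_mono h

lemma ln_strict {P Q : Submodule R M} (h : P < Q) : ln R P < ln R Q := by
  rw [← ENat.natCast_lt_natCast, coe_ln, coe_ln, Module.length_submodule, Module.length_submodule]
  exact Submodule.height_strictMono h

lemma ln_map_add (g : M →ₗ[R] N) (P : Submodule R M) :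
    ln R (P.map g) + ln R (P ⊓ LinearMap.ker g) = ln R P := by
  have h := ln_add (g ∘ₗ P.subtype)
  have h1 : ln R (⊤ : Submodule R P) = ln R P := by simp [ln]
  have h2 : LinearMap.range (g ∘ₗ P.subtype) = P.map g := by
    rw [LinearMap.range_comp, Submodule.range_subtype]
  have h3 : ln R (LinearMap.ker (g ∘ₗ P.subtype)) = ln R (P ⊓ LinearMap.ker g) := by
    rw [LinearMap.ker_comp, inf_comm]
    unfold ln
    congr 1
    rw [LinearEquiv.length_eq (Submodule.equivMapOfInjective P.subtype (Submodule.injective_subtype _)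
      (Submodule.comap P.subtype (LinearMap.ker g)))]
    rw [Submodule.map_comap_subtype, inf_comm]
  rw [h1, h2, h3] at h
  exact h

lemma ln_map_of_ker_le (g : M →ₗ[R] N) (P : Submodule R M) (h : LinearMap.ker g ≤ P) :
    ln R (P.map g) + ln R (LinearMap.ker g) = ln R P := by
  have := ln_map_add g P
  rwa [inf_eq_right.mpr h] at this

lemma ln_map_inj (g : M →ₗ[R] N) (hg : Function.Injective g) (P : Submodule R M) :
    ln R (P.map g) = ln R P := by
  have := ln_map_add g P
  rw [LinearMap.ker_eq_bot.mpr hg] at this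
  have h0 : ln R (P ⊓ ⊥) = 0 := by rw [inf_bot_eq]; simp [ln]
  omega

lemma ln_comap (g : M →ₗ[R] N) (P : Submodule R N) (h : P ≤ LinearMap.range g) :
    ln R (P.comap g) = ln R P + ln R (LinearMap.ker g) := by
  have := ln_map_of_ker_le g (P.comap g) (by
    intro x hx; simp only [LinearMap.mem_ker] at hx; simp [hx])
  rw [Submodule.map_comap_eq, inf_eq_right.mpr h] at this
  exact this.symm

lemma length_quot_add (P : Submodule R M) :
    Module.length R (M ⧸ P) + ln R P = ln R (⊤ : Submodule R M) := by
  rw [coe_ln, coe_ln, Module.length_top, add_comm]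
  exact (Module.length_eq_add_of_exact P.subtype P.mkQ
    (Submodule.injective_subtype _) (Submodule.mkQ_surjective _) (LinearMap.exact_subtype_mkQ P)).symm

lemma mem_smul_top_pi {R : Type} [CommRing R] (n : ℕ) (I : Ideal R) (x : Fin n → R) :
    x ∈ I • (⊤ : Submodule R (Fin n → R)) ↔ ∀ i, x i ∈ I := by
  constructor
  · intro h i
    have := Submodule.mem_map_of_mem (f := LinearMap.proj (R := R) (φ := fun _ : Fin n => R) i) h
    rw [Submodule.map_smul''] at this
    have h2 := Submodule.smul_mono le_rfl (le_top : Submodule.map (LinearMap.proj (R := R) (φ := fun _ : Fin n => R) i) ⊤ ≤ ⊤) this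
    simpa using h2
  · intro h
    rw [pi_eq_sum_univ x]
    exact Submodule.sum_mem _ fun i _ => Submodule.smul_mem_smul (h i) trivial

lemma smul_top_equiv {F G : Type} [AddCommGroup F] [Module R F] [AddCommGroup G] [Module R G]
    (e : F ≃ₗ[R] G) (I : Ideal R) (x : F) :
    e x ∈ I • (⊤ : Submodule R G) ↔ x ∈ I • (⊤ : Submodule R F) := by
  have : I • (⊤ : Submodule R G) = (I • (⊤ : Submodule R F)).map e.toLinearMap := by
    rw [Submodule.map_smul'', Submodule.map_top, LinearEquiv.range]
  rw [this]
  constructor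
  · rintro ⟨y, hy, hxy⟩
    have : y = x := e.injective hxy
    rwa [← this]
  · intro h; exact ⟨x, h, rfl⟩

lemma exists_equiv (M : Type) [AddCommGroup M] [Module R M] [Module.Finite R M] [Nontrivial R]
    (hM : Module.Free R M) : Nonempty (M ≃ₗ[R] (Fin (Module.finrank R M) → R)) :=
  ⟨(Module.finBasis R M).equivFun⟩

lemma ln_smul_top [Nontrivial R] (hM : Module.Free R M) (I : Ideal R) :
    ln R (I • (⊤ : Submodule R M)) = Module.finrank R M * ln R I := by
  obtain ⟨e⟩ := exists_equiv (R := R) M hM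
  rw [← ln_map_inj e.toLinearMap e.injective, Submodule.map_smul'', Submodule.map_top, LinearEquiv.range]
  rw [← ENat.natCast_inj]
  push_cast
  rw [coe_ln, coe_ln]
  let φ : (I • (⊤ : Submodule R (Fin (Module.finrank R M) → R)) : Submodule R _) ≃ₗ[R] (Fin (Module.finrank R M) → I) :=
    { toFun := fun x i => ⟨x.1 i, (mem_smul_top_pi _ _ _).1 x.2 i⟩
      invFun := fun y => ⟨fun i => (y i).1, (mem_smul_top_pi _ _ _).2 fun i => (y i).2⟩
      map_add' := fun _ _ => rfl
      map_smul' := fun _ _ => rfl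
      left_inv := fun _ => rfl
      right_inv := fun _ => rfl }
  rw [φ.length_eq, Module.length_pi]
  simp

lemma ln_top_free [Nontrivial R] (hM : Module.Free R M) :
    ln R (⊤ : Submodule R M) = Module.finrank R M * ln R (⊤ : Ideal R) := by
  rw [← ln_smul_top hM, Submodule.top_smul]

end

section
variable {R : Type} [CommRing R] [IsArtinianRing R] [IsLocalRing R]
variable {F M : Type} [AddCommGroup M] [Module R M] [Module.Finite R M]
  [AddCommGroup F] [Module R F] [Module.Finite R F]

lemma mem_socle (x : R) : x ∈ socle R ↔ ∀ c ∈ maximalIdeal R, c * x = 0 := by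
  rw [socle, Submodule.mem_colon]
  simp [mul_comm]

lemma mem_socle_smul (hM : Module.Free R M) (x : M) :
    x ∈ socle R • (⊤ : Submodule R M) ↔ ∀ c ∈ maximalIdeal R, c • x = 0 := by
  have e := (Module.finBasis R M).equivFun
  rw [← smul_top_equiv e, mem_smul_top_pi]
  have : ∀ c : R, c • x = 0 ↔ ∀ i, c * e x i = 0 := by
    intro c
    rw [← e.map_eq_zero_iff, map_smul, funext_iff]
    rfl
  simp only [this, mem_socle]
  tauto

lemma auto (θ : F →ₗ[R] F) (h : ∀ x, θ x - x ∈ maximalIdeal R • (⊤ : Submodule R F)) :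
    Function.Bijective θ := by
  have hs : Function.Surjective θ := by
    rw [← LinearMap.range_eq_top]
    have := Submodule.le_of_le_smul_of_le_jacobson_bot (I := maximalIdeal R) (N := LinearMap.range θ)
      (N' := (⊤ : Submodule R F)) Module.Finite.fg_top (IsLocalRing.maximalIdeal_le_jacobson _) (by
        intro x _
        have h1 : x = θ x - (θ x - x) := by abel
        rw [h1]
        exact Submodule.sub_mem_sup ⟨x, rfl⟩ (h x))
    exact top_le_iff.mp this
  exact ⟨(OrzechProperty.injective_of_surjective_endomorphism θ hs), hs⟩

lemma retract_fix (g : F →ₗ[R] M) (p : M →ₗ[R] F)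
    (h : ∀ x, p (g x) - x ∈ maximalIdeal R • (⊤ : Submodule R F)) :
    ∃ θ : F ≃ₗ[R] F, (∀ x, θ x = p (g x)) :=
  ⟨LinearEquiv.ofBijective (p ∘ₗ g) (auto _ h), fun _ => rfl⟩

lemma exists_split (hM : Module.Free R M) (g : F →ₗ[R] M)
    (h : (maximalIdeal R • (⊤ : Submodule R M)).comap g ≤ maximalIdeal R • (⊤ : Submodule R F)) :
    ∃ p : M →ₗ[R] F, p ∘ₗ g = LinearMap.id := by
  letI : Field (R ⧸ maximalIdeal R) := Ideal.Quotient.field _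
  let gb : (F ⧸ (maximalIdeal R • (⊤ : Submodule R F))) →ₗ[R] (M ⧸ (maximalIdeal R • (⊤ : Submodule R M))) :=
    Submodule.mapQ _ _ g (by
      rw [← Submodule.map_le_iff_le_comap, Submodule.map_smul'']
      exact Submodule.smul_mono le_rfl le_top)
  let gk : (F ⧸ (maximalIdeal R • (⊤ : Submodule R F))) →ₗ[R ⧸ maximalIdeal R] (M ⧸ (maximalIdeal R • (⊤ : Submodule R M))) :=
    LinearMap.extendScalarsOfSurjective Ideal.Quotient.mk_surjective gb
  have hk : LinearMap.ker gk = ⊥ := by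
    rw [LinearMap.ker_eq_bot']
    intro x hx
    obtain ⟨x, rfl⟩ := Submodule.mkQ_surjective _ x
    have hx' : gb (Submodule.mkQ _ x) = 0 := hx
    simp only [gb, Submodule.mkQ_apply, Submodule.mapQ_apply, Submodule.Quotient.mk_eq_zero] at hx' ⊢
    exact h hx'
  obtain ⟨pk, hpk⟩ := gk.exists_leftInverse_of_injective hk
  obtain ⟨p, hp⟩ := Module.projective_lifting_property (Submodule.mkQ (maximalIdeal R • (⊤ : Submodule R F)))
    ((pk.restrictScalars R) ∘ₗ Submodule.mkQ _) (Submodule.mkQ_surjective _)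
  have key : ∀ x, p (g x) - x ∈ maximalIdeal R • (⊤ : Submodule R F) := by
    intro x
    rw [← Submodule.Quotient.mk_eq_zero, Submodule.Quotient.mk_sub, sub_eq_zero]
    have h1 := LinearMap.congr_fun hp (g x)
    have h2 := LinearMap.congr_fun hpk (Submodule.mkQ _ x)
    exact h1.trans h2
  obtain ⟨θ, hθ⟩ := retract_fix g p key
  refine ⟨θ.symm.toLinearMap ∘ₗ p, ?_⟩
  ext x
  simp [← hθ]

/-- minimal cover -/
lemma exists_cover (P : Submodule R M) (hP : maximalIdeal R • (⊤ : Submodule R M) ≤ P) :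
    ∃ (w : ℕ) (g : (Fin w → R) →ₗ[R] M), P.comap g = maximalIdeal R • (⊤ : Submodule R (Fin w → R)) ∧
      LinearMap.range g ⊔ P = ⊤ ∧ w + ln R P = ln R (⊤ : Submodule R M) := by
  letI : Field (R ⧸ maximalIdeal R) := Ideal.Quotient.field _
  have hT : Module.IsTorsionBySet R (M ⧸ P) (maximalIdeal R : Set R) := by
    intro x c
    obtain ⟨x, rfl⟩ := Submodule.mkQ_surjective _ x
    change (c : R) • (Submodule.Quotient.mk x) = (0 : M ⧸ P)
    rw [← Submodule.Quotient.mk_smul, Submodule.Quotient.mk_eq_zero]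
    exact hP (Submodule.smul_mem_smul c.2 trivial)
  letI : Module (R ⧸ maximalIdeal R) (M ⧸ P) := hT.module
  haveI : IsScalarTower R (R ⧸ maximalIdeal R) (M ⧸ P) := hT.isScalarTower
  haveI : Module.Finite (R ⧸ maximalIdeal R) (M ⧸ P) := Module.Finite.of_restrictScalars_finite R _ _
  let b := Module.finBasis (R ⧸ maximalIdeal R) (M ⧸ P)
  set w := Module.finrank (R ⧸ maximalIdeal R) (M ⧸ P)
  choose v hv using fun i => Submodule.mkQ_surjective P (b i)
  let g : (Fin w → R) →ₗ[R] M := Fintype.linearCombination R v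
  have hg : ∀ x, P.mkQ (g x) = ∑ i, (Ideal.Quotient.mk (maximalIdeal R) (x i)) • b i := by
    intro x
    simp only [g, Fintype.linearCombination_apply, map_sum, map_smul, hv]
    rfl
  refine ⟨w, g, ?_, ?_, ?_⟩
  · ext x
    rw [mem_smul_top_pi, Submodule.mem_comap, ← Submodule.Quotient.mk_eq_zero, ← Submodule.mkQ_apply, hg]
    constructor
    · intro h i
      have := Fintype.linearIndependent_iff.mp b.linearIndependent _ h i
      exact Ideal.Quotient.eq_zero_iff_mem.mp this
    · intro h
      apply Finset.sum_eq_zero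
      intro i _
      rw [Ideal.Quotient.eq_zero_iff_mem.mpr (h i), zero_smul]
  · rw [eq_top_iff]
    intro y _
    choose c hc using fun i => Ideal.Quotient.mk_surjective (b.repr (P.mkQ y) i)
    have : P.mkQ (g c) = P.mkQ y := by
      rw [hg]
      simp only [hc]
      exact b.sum_repr _
    have h2 : y - g c ∈ P := by
      rw [← Submodule.Quotient.mk_eq_zero, Submodule.Quotient.mk_sub, sub_eq_zero]
      exact this.symm
    have h3 : y = g c + (y - g c) := by abel
    rw [h3]
    exact Submodule.add_mem_sup ⟨c, rfl⟩ h2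
  · rw [← ENat.natCast_inj, ← length_quot_add P]
    push_cast
    congr 1
    rw [Module.length_eq_of_surjective (R := R ⧸ maximalIdeal R) (S := R) Ideal.Quotient.mk_surjective,
      Module.length_eq_finrank]
end
end TB
namespace TB
set_option linter.unusedSectionVars false
set_option linter.style.haveILetI false
section
variable {R : Type} [CommRing R] [IsArtinianRing R] [IsLocalRing R]
variable {A B : Type} [AddCommGroup A] [Module R A] [Module.Finite R A]
  [AddCommGroup B] [Module R B] [Module.Finite R B]

lemma exists_lift {P X Y : Type} [AddCommGroup P] [Module R P] [AddCommGroup X] [Module R X]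
    [AddCommGroup Y] [Module R Y] (hP : Module.Free R P) (s : X →ₗ[R] Y) (t : P →ₗ[R] Y)
    (h : LinearMap.range t ≤ LinearMap.range s) : ∃ u : P →ₗ[R] X, s ∘ₗ u = t := by
  obtain ⟨u, hu⟩ := Module.projective_lifting_property s.rangeRestrict
    (t.codRestrict (LinearMap.range s) (fun x => h ⟨x, rfl⟩)) s.surjective_rangeRestrict
  refine ⟨u, ?_⟩
  ext x
  have := congrArg Subtype.val (LinearMap.congr_fun hu x)
  simpa using this

lemma map_smul_le (I : Ideal R) (p : A →ₗ[R] B) :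
    (I • (⊤ : Submodule R A)).map p ≤ I • (⊤ : Submodule R B) := by
  rw [Submodule.map_smul'']
  exact Submodule.smul_mono le_rfl le_top

lemma exists_functional (hA : Module.Free R A) (x : A) (hx : x ∉ maximalIdeal R • (⊤ : Submodule R A)) :
    ∃ p : A →ₗ[R] R, p x = 1 := by
  obtain ⟨p, hp⟩ := exists_split hA (LinearMap.toSpanSingleton R A x) (by
    intro c hc
    by_contra hcm
    apply hx
    have hu : IsUnit c := by
      by_contra hn
      apply hcm
      have : c ∈ maximalIdeal R := (mem_maximalIdeal c).mpr hn
      simpa using this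
    obtain ⟨u, rfl⟩ := hu
    have := Submodule.smul_mem _ (↑u⁻¹ : R) hc
    simpa [smul_smul] using this)
  refine ⟨p, ?_⟩
  simpa using LinearMap.congr_fun hp 1

lemma kSummand_iff (hA : Module.Free R A) (Z : Submodule R A)
    (hZ : Z ≤ maximalIdeal R • (⊤ : Submodule R A)) :
    kSummand R (A ⧸ Z) ↔ ∃ x, x ∉ maximalIdeal R • (⊤ : Submodule R A) ∧
      ∀ c ∈ maximalIdeal R, c • x ∈ Z := by
  constructor
  · rintro ⟨φ, γ, h⟩
    obtain ⟨x, hx⟩ := Submodule.mkQ_surjective Z (γ 1)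
    have kz : ∀ c ∈ maximalIdeal R, ∀ y : ResidueField R, c • y = 0 := by
      intro c hc y
      rw [Algebra.smul_def]
      have : algebraMap R (ResidueField R) c = 0 := (IsLocalRing.residue_eq_zero_iff c).mpr hc
      rw [this, zero_mul]
    refine ⟨x, fun hxm => ?_, fun c hc => ?_⟩
    · have h1 : φ (Z.mkQ x) = 1 := by rw [hx]; exact LinearMap.congr_fun h 1
      have h2 : ∀ y ∈ maximalIdeal R • (⊤ : Submodule R A), φ (Z.mkQ y) = 0 := by
        intro y hy
        refine Submodule.smul_induction_on hy ?_ ?_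
        · intro c hc n _
          rw [map_smul, map_smul, kz c hc]
        · intro a b ha hb
          rw [map_add, map_add, ha, hb, add_zero]
      rw [h2 x hxm] at h1
      exact zero_ne_one h1
    · rw [← Submodule.Quotient.mk_eq_zero, ← Submodule.mkQ_apply, map_smul, hx, ← map_smul, kz c hc, map_zero]
  · rintro ⟨x, hx, hc⟩
    obtain ⟨p, hp⟩ := exists_functional hA x hx
    let φ : (A ⧸ Z) →ₗ[R] ResidueField R := Z.liftQ ((Algebra.linearMap R (ResidueField R)) ∘ₗ p) (by
      intro y hy
      have h1 := map_smul_le (maximalIdeal R) p (Submodule.mem_map_of_mem (hZ hy))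
      have h2 : p y ∈ maximalIdeal R := by simpa using h1
      exact (IsLocalRing.residue_eq_zero_iff _).mpr h2)
    let γ : (R ⧸ maximalIdeal R) →ₗ[R] (A ⧸ Z) :=
      Submodule.liftQ (maximalIdeal R) (LinearMap.toSpanSingleton R _ (Z.mkQ x)) (by
        intro c hcm
        rw [LinearMap.mem_ker, LinearMap.toSpanSingleton_apply, ← map_smul, Submodule.mkQ_apply,
          Submodule.Quotient.mk_eq_zero]
        exact hc c hcm)
    refine ⟨φ, γ, ?_⟩
    ext y
    obtain ⟨y, rfl⟩ := Ideal.Quotient.mk_surjective y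
    have h1 : γ (Ideal.Quotient.mk (maximalIdeal R) y) = y • Z.mkQ x := by
      exact Submodule.liftQ_apply _ _ _
    have h2 : φ (Z.mkQ x) = 1 := by
      change (Algebra.linearMap R (ResidueField R)) (p x) = 1
      rw [hp]; simp
    change φ (γ (Ideal.Quotient.mk (maximalIdeal R) y)) = _
    rw [h1, map_smul, h2, Algebra.smul_def, mul_one]
    rfl

lemma ln_ideal_smul_top_pi (w : ℕ) (I : Ideal R) :
    ln R (I • (⊤ : Submodule R (Fin w → R))) = w * ln R I := by
  rw [ln_smul_top inferInstance]; simp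

lemma mW_bound (hA : Module.Free R A) (W : Submodule R A)
    (hW : maximalIdeal R • (⊤ : Submodule R A) ≤ W) (e f w : ℕ)
    (hef : ln R (maximalIdeal R) = e + f) (hf : ln R (maximalIdeal R ^ 2) = f)
    (hw : w + ln R (maximalIdeal R • (⊤ : Submodule R A)) = ln R W) :
    f * Module.finrank R A + e * w ≤
      ln R (maximalIdeal R • W ⊔ maximalIdeal R ^ 2 • (⊤ : Submodule R A)) := by
  obtain ⟨w', g, hg1, -, hg3⟩ := exists_cover (M := W)
    ((maximalIdeal R • (⊤ : Submodule R A)).comap W.subtype) (by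
      rw [← Submodule.map_le_iff_le_comap]
      exact map_smul_le _ _)
  have h1 : ln R (⊤ : Submodule R W) = ln R W := by simp [ln]
  rw [h1, ln_comap W.subtype _ (by rw [Submodule.range_subtype]; exact hW), Submodule.ker_subtype] at hg3
  have h0 : ln R (⊥ : Submodule R W) = 0 := by simp [ln]
  have hww : w' = w := by omega
  subst hww
  set g' := W.subtype ∘ₗ g with hg'
  have hc : (maximalIdeal R • (⊤ : Submodule R A)).comap g' =
      maximalIdeal R • (⊤ : Submodule R (Fin w' → R)) := by
    rw [hg', Submodule.comap_comp, hg1]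
  obtain ⟨p, hp⟩ := exists_split hA g' hc.le
  set S := maximalIdeal R ^ 2 • (⊤ : Submodule R A) with hS
  have k1 := ln_map_add (S.mkQ ∘ₗ g') (maximalIdeal R • (⊤ : Submodule R (Fin w' → R)))
  have k2 : ln R (maximalIdeal R • (⊤ : Submodule R (Fin w' → R)) ⊓ LinearMap.ker (S.mkQ ∘ₗ g')) ≤
      ln R (maximalIdeal R ^ 2 • (⊤ : Submodule R (Fin w' → R))) := by
    apply ln_mono
    intro x hx
    have hx2 : x ∈ LinearMap.ker (S.mkQ ∘ₗ g') := hx.2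
    rw [LinearMap.mem_ker, LinearMap.comp_apply, Submodule.mkQ_apply, Submodule.Quotient.mk_eq_zero] at hx2
    have := map_smul_le _ p (Submodule.mem_map_of_mem hx2)
    have hpx : p (g' x) = x := LinearMap.congr_fun hp x
    rwa [hpx] at this
  have k3 := ln_map_of_ker_le S.mkQ (maximalIdeal R • W ⊔ S) (by rw [Submodule.ker_mkQ]; exact le_sup_right)
  rw [Submodule.ker_mkQ] at k3
  have k4 : ln R ((maximalIdeal R • (⊤ : Submodule R (Fin w' → R))).map (S.mkQ ∘ₗ g')) ≤
      ln R ((maximalIdeal R • W ⊔ S).map S.mkQ) := by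
    apply ln_mono
    rw [Submodule.map_comp]
    apply Submodule.map_mono
    refine le_trans ?_ le_sup_left
    rw [Submodule.map_smul'']
    refine Submodule.smul_mono le_rfl ?_
    rintro _ ⟨x, _, rfl⟩
    exact (g x).2
  rw [ln_ideal_smul_top_pi, hf] at k2
  rw [ln_ideal_smul_top_pi, hef] at k1
  have k5 : ln R S = Module.finrank R A * f := by rw [hS, ln_smul_top hA, hf]
  nlinarith

/-- Growth data. -/
def Gd (e f : ℕ) (Z : Submodule R A) (n : ℕ) : Prop :=
  ∃ (w : ℕ) (g : (Fin w → R) →ₗ[R] A) (p : A →ₗ[R] (Fin w → R)) (Y : Submodule R (Fin w → R)),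
    p ∘ₗ g = LinearMap.id ∧ Y ≤ maximalIdeal R • (⊤ : Submodule R (Fin w → R)) ∧
    Y.map g ≤ Z ∧ Z.map p ≤ Y ∧ n + 1 ≤ w ∧ e * w + f ≤ ln R Y

lemma Gd_le [Module.Free R A] (e f : ℕ) (Z : Submodule R A) (n : ℕ) (h : Gd e f Z n) :
    n + 1 ≤ Module.finrank R A := by
  obtain ⟨w, g, p, Y, hpg, -, -, -, hn, -⟩ := h
  have hinj : Function.Injective g := by
    apply Function.LeftInverse.injective (g := p)
    intro x; exact LinearMap.congr_fun hpg x
  have := LinearMap.finrank_le_finrank_of_injective hinj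
  simp at this
  omega

lemma Gd_start (hA : Module.Free R A) (e f : ℕ) (Z : Submodule R A)
    (hZ : Z ≤ maximalIdeal R • (⊤ : Submodule R A))
    (hef : ln R (maximalIdeal R) = e + f) (x : A) (hx : x ∉ maximalIdeal R • (⊤ : Submodule R A))
    (hxZ : ∀ c ∈ maximalIdeal R, c • x ∈ Z) : Gd e f Z 0 := by
  obtain ⟨p, hp⟩ := exists_functional hA x hx
  refine ⟨1, (LinearMap.toSpanSingleton R A x) ∘ₗ LinearMap.proj 0, LinearMap.pi fun _ => p,
    maximalIdeal R • ⊤, ?_, le_rfl, ?_, ?_, le_rfl, ?_⟩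
  · apply LinearMap.ext
    intro v
    funext i
    fin_cases i
    simp [hp]
  · rintro _ ⟨v, hv, rfl⟩
    exact hxZ _ ((mem_smul_top_pi _ _ _).1 hv 0)
  · rintro _ ⟨v, hv, rfl⟩
    exact map_smul_le _ _ (Submodule.mem_map_of_mem (hZ hv))
  · rw [ln_ideal_smul_top_pi, hef]; omega

lemma Gd_step (hB : Module.Free R B) (d : B →ₗ[R] A) (e f : ℕ)
    (hef1 : ln R (⊤ : Ideal R) = 1 + e + f) (hf : ln R (maximalIdeal R ^ 2) = f)
    (hf1 : 1 ≤ f) (hfe : f + 1 ≤ e) (n : ℕ)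
    (h : Gd e f (LinearMap.range d) n) : Gd e f (LinearMap.ker d) (n + 1) := by
  obtain ⟨w, g, p, Y, hpg, hY, hgY, hpZ, hn, hlY⟩ := h
  obtain ⟨w', g0, c1, c2, c3⟩ := exists_cover (M := Y) (maximalIdeal R • ⊤) le_rfl
  have hg0 : LinearMap.range g0 = ⊤ := by
    have := Submodule.le_of_le_smul_of_le_jacobson_bot (I := maximalIdeal R) (N := LinearMap.range g0)
      (N' := (⊤ : Submodule R Y)) Module.Finite.fg_top (IsLocalRing.maximalIdeal_le_jacobson _) c2.ge
    exact top_le_iff.mp this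
  have hlt : ln R (⊤ : Submodule R Y) = ln R Y := by simp [ln]
  have hlm : ln R (maximalIdeal R • (⊤ : Submodule R Y)) ≤ w * f := by
    rw [← ln_map_inj Y.subtype (Submodule.injective_subtype _), Submodule.map_smul'',
      Submodule.map_top, Submodule.range_subtype, ← hf, ← ln_ideal_smul_top_pi]
    apply ln_mono
    rw [pow_two, mul_smul]
    exact Submodule.smul_mono le_rfl hY
  set π := Y.subtype ∘ₗ g0 with hπ
  have hrπ : LinearMap.range π = Y := by
    rw [hπ, LinearMap.range_comp, hg0, Submodule.map_top, Submodule.range_subtype]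
  have hkπ : LinearMap.ker π ≤ maximalIdeal R • (⊤ : Submodule R (Fin w' → R)) := by
    rw [← c1]
    intro x hx
    have : g0 x = 0 := by
      apply Subtype.ext
      exact hx
    rw [Submodule.mem_comap, this]
    exact zero_mem _
  have hlen := ln_add π
  rw [hrπ, ln_top_free inferInstance, hef1] at hlen
  simp only [Module.finrank_fintype_fun_eq_card, Fintype.card_fin] at hlen
  obtain ⟨g', hg'⟩ := exists_lift (R := R) (P := Fin w' → R) inferInstance d (g ∘ₗ π) (by
    rw [LinearMap.range_comp, hrπ]; exact hgY)
  obtain ⟨p', hp'⟩ := exists_lift (R := R) (P := B) hB π (p ∘ₗ d) (by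
    rw [LinearMap.range_comp, hrπ]; exact hpZ)
  have hπpg : ∀ x, π (p' (g' x)) = π x := by
    intro x
    have h1 := LinearMap.congr_fun hp' (g' x)
    have h2 := LinearMap.congr_fun hg' x
    have h3 := LinearMap.congr_fun hpg (π x)
    simp only [LinearMap.comp_apply, LinearMap.id_apply] at h1 h2 h3 ⊢
    rw [h1, h2, h3]
  obtain ⟨θ, hθ⟩ := retract_fix g' p' (by
    intro x
    apply hkπ
    rw [LinearMap.mem_ker, map_sub, hπpg, sub_self])
  have hθπ : ∀ x, π (θ.symm x) = π x := by
    intro x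
    have := hπpg (θ.symm x)
    rw [← hθ, LinearEquiv.apply_symm_apply] at this
    exact this.symm
  refine ⟨w', g', θ.symm.toLinearMap ∘ₗ p', LinearMap.ker π, ?_, hkπ, ?_, ?_, ?_, ?_⟩
  · apply LinearMap.ext
    intro x
    simp [← hθ]
  · rintro _ ⟨x, hx, rfl⟩
    have h2 := LinearMap.congr_fun hg' x
    rw [LinearMap.comp_apply, LinearMap.comp_apply, (hx : π x = 0), map_zero] at h2
    exact h2
  · rintro _ ⟨x, hx, rfl⟩
    have h1 := LinearMap.congr_fun hp' x
    have h1' : π (p' x) = p (d x) := h1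
    rw [(hx : d x = 0), map_zero] at h1'
    change π (θ.symm (p' x)) = 0
    rw [hθπ, h1']
  · rw [hlt] at c3
    nlinarith
  · rw [hlt] at c3
    have : w + f ≤ w' := by nlinarith
    have : f * (w + f) ≤ f * w' := Nat.mul_le_mul_left _ this
    nlinarith

lemma sq_le_socle (h3 : maximalIdeal R ^ 3 = ⊥) : maximalIdeal R ^ 2 ≤ socle R := by
  intro x hx
  rw [mem_socle]
  intro c hc
  have : c * x ∈ maximalIdeal R ^ 3 := by
    rw [pow_succ' _ 2]
    exact Ideal.mul_mem_mul hc hx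
  rwa [h3] at this

/-- numeric facts at one differential -/
lemma pair_facts (h3 : maximalIdeal R ^ 3 = ⊥) (hA : Module.Free R A) (hB : Module.Free R B)
    (d : B →ₗ[R] A) (e f r : ℕ)
    (hef1 : ln R (⊤ : Ideal R) = 1 + e + f) (hef : ln R (maximalIdeal R) = e + f)
    (hf : ln R (maximalIdeal R ^ 2) = f) (hr : ln R (socle R) = r)
    (hd : LinearMap.range d ≤ maximalIdeal R • (⊤ : Submodule R A))
    (hk : LinearMap.ker d ≤ maximalIdeal R • (⊤ : Submodule R B))
    (hsA : socle R • (⊤ : Submodule R A) ≤ LinearMap.range d)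
    (hsB : socle R • (⊤ : Submodule R B) ≤ LinearMap.ker d) :
    ln R (LinearMap.range d) + ln R (LinearMap.ker d) = (1 + e + f) * Module.finrank R B ∧
    (e + f) * Module.finrank R B ≤ f * Module.finrank R A + ln R (LinearMap.ker d) ∧
    ∃ q : ℕ, (e + f) * Module.finrank R B + q = r * Module.finrank R A + ln R (LinearMap.ker d) ∧
      f * Module.finrank R B + e * q ≤ ln R (LinearMap.ker d) ∧
      (kSummand R (B ⧸ LinearMap.ker d) ↔ 0 < q) := by
  have hmm : (maximalIdeal R • (⊤ : Submodule R B)).map d ≤ maximalIdeal R ^ 2 • (⊤ : Submodule R A) := by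
    rw [Submodule.map_smul'', Submodule.map_top, pow_two, mul_smul]
    exact Submodule.smul_mono le_rfl hd
  have hss : maximalIdeal R ^ 2 • (⊤ : Submodule R A) ≤ socle R • (⊤ : Submodule R A) :=
    Submodule.smul_mono (sq_le_socle h3) le_rfl
  have hssB : maximalIdeal R ^ 2 • (⊤ : Submodule R B) ≤ socle R • (⊤ : Submodule R B) :=
    Submodule.smul_mono (sq_le_socle h3) le_rfl
  set W := (socle R • (⊤ : Submodule R A)).comap d with hWd
  have hmW : maximalIdeal R • (⊤ : Submodule R B) ≤ W := by
    rw [hWd, ← Submodule.map_le_iff_le_comap]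
    exact hmm.trans hss
  have hlW : ln R W = r * Module.finrank R A + ln R (LinearMap.ker d) := by
    rw [hWd, ln_comap d _ hsA, ln_smul_top hA, hr, mul_comm]
  have hlm : ln R (maximalIdeal R • (⊤ : Submodule R B)) = (e + f) * Module.finrank R B := by
    rw [ln_smul_top hB, hef, mul_comm]
  have hWmem : ∀ x, x ∈ W ↔ ∀ c ∈ maximalIdeal R, c • x ∈ LinearMap.ker d := by
    intro x
    rw [hWd, Submodule.mem_comap, mem_socle_smul hA]
    simp
  refine ⟨?_, ?_, ln R W - ln R (maximalIdeal R • (⊤ : Submodule R B)), ?_, ?_, ?_⟩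
  · rw [ln_add, ln_top_free hB, hef1, mul_comm]
  · have h1 := ln_map_of_ker_le d _ hk
    have h2 := ln_mono hmm
    rw [ln_smul_top hA, hf] at h2
    rw [← hlm, ← h1]
    nlinarith
  · have := ln_mono hmW
    omega
  · have h1 := mW_bound hB W hmW e f (ln R W - ln R (maximalIdeal R • (⊤ : Submodule R B))) hef hf (by
      have := ln_mono hmW
      omega)
    refine h1.trans (ln_mono (sup_le ?_ (hssB.trans hsB)))
    rw [Submodule.smul_le]
    intro c hc x hx
    exact (hWmem x).1 hx c hc
  · rw [kSummand_iff hB _ hk]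
    constructor
    · rintro ⟨x, hx, hc⟩
      have : maximalIdeal R • (⊤ : Submodule R B) < W :=
        lt_of_le_of_ne hmW (fun h => hx (h ▸ (hWmem x).2 hc))
      have := ln_strict this
      omega
    · intro hq
      have : ¬ W ≤ maximalIdeal R • (⊤ : Submodule R B) := by
        intro hle
        have := ln_mono hle
        omega
      obtain ⟨x, hx, hxm⟩ := Set.not_subset.mp this
      exact ⟨x, hxm, (hWmem x).1 hx⟩

end
end TB
namespace TB
set_option linter.unusedSectionVars false
section
variable {R : Type} [CommRing R] [IsArtinianRing R] [IsLocalRing R]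

lemma ln_ring_top : ln R (⊤ : Ideal R) = 1 + ln R (maximalIdeal R) := by
  rw [← ENat.natCast_inj, ← length_quot_add (maximalIdeal R)]
  push_cast
  congr 1
  haveI : IsSimpleModule R (R ⧸ maximalIdeal R) :=
    isSimpleModule_iff_isCoatom.mpr (Ideal.isMaximal_def.mp inferInstance)
  exact Module.length_eq_one R _

lemma ln_max : ∃ e : ℕ, embdim R = e ∧ ln R (maximalIdeal R) = e + ln R (maximalIdeal R ^ 2) := by
  have : Module.Finite R (maximalIdeal R).Cotangent :=
    Module.Finite.of_surjective (maximalIdeal R).toCotangent (Ideal.toCotangent_surjective _)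
  have h := ln_add (maximalIdeal R).toCotangent
  have h1 : ln R (⊤ : Submodule R (maximalIdeal R)) = ln R (maximalIdeal R) := by simp [ln]
  have h2 : ln R (LinearMap.ker (maximalIdeal R).toCotangent) = ln R (maximalIdeal R ^ 2) := by
    rw [← ln_map_inj (maximalIdeal R).subtype (Submodule.injective_subtype _)]
    congr 1
    ext x
    constructor
    · rintro ⟨y, hy, rfl⟩
      exact (Ideal.mem_toCotangent_ker _).1 hy
    · intro hx
      exact ⟨⟨x, Ideal.pow_le_self two_ne_zero hx⟩, (Ideal.mem_toCotangent_ker _).2 hx, rfl⟩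
  rw [h1, h2, Ideal.toCotangent_range] at h
  refine ⟨_, ?_, h.symm⟩
  rw [coe_ln, embdim, moduleLength_eq, Module.length_top]

end
end TB

/-- Theorem B: let `(R, m, k)` be a local ring with `m³ = 0 ≠ m²` which is not
Gorenstein (equivalently, `r ≥ 2`), and let `A` be a non-zero minimal acyclic complex
of finitely generated free `R`-modules, with differentials `d i : A (i+1) → A i` (so
that `∂_j = d (j-1)` and `Coker ∂_{j+1} = A j ⧸ im (d j)`).  Then exactly one of the
following holds:
(I) `k` is not a direct summand of `Coker ∂_i` for any `i`, and there is `a > 0` with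
`rank A_i = a` and `ℓ(Coker ∂_i) = a·e` for all `i`; or
(II) there is `κ` such that `k` is a direct summand of `Coker ∂_{κ+2}` but not of
`Coker ∂_{i+2}` for any `i < κ`, and there is `a > 0` with `rank A_i = a` for `i ≤ κ`,
`rank A_{i+1} > rank A_i` for `i ≥ κ`, and `ℓ(Coker ∂_{i+2}) = a·e` for `i ≤ κ`. -/
theorem theorem_B (R : Type) [CommRing R] [IsNoetherianRing R] [IsLocalRing R]
    (h3 : maximalIdeal R ^ 3 = ⊥) (h2 : maximalIdeal R ^ 2 ≠ ⊥)
    (hnotGor : 2 ≤ socdim R)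
    (A : ℤ → Type) [∀ i, AddCommGroup (A i)] [∀ i, Module R (A i)]
    (hfree : ∀ i, Module.Free R (A i)) (hfin : ∀ i, Module.Finite R (A i))
    (d : ∀ i : ℤ, A (i + 1) →ₗ[R] A i)
    (hcx : ∀ i, d i ∘ₗ d (i + 1) = 0)
    (hacyclic : ∀ i, LinearMap.range (d (i + 1)) = LinearMap.ker (d i))
    (hmin : ∀ i, LinearMap.range (d i) ≤ maximalIdeal R • (⊤ : Submodule R (A i)))
    (hnz : ∃ i, Nontrivial (A i)) :
    Xor'
      ((∀ i : ℤ, ¬ kSummand R (A i ⧸ LinearMap.range (d i))) ∧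
        ∃ a : ℕ, 0 < a ∧ (∀ i : ℤ, Module.finrank R (A i) = a) ∧
          ∀ i : ℤ, moduleLength R (A i ⧸ LinearMap.range (d i)) = (a : ℕ∞) * embdim R)
      (∃ κ : ℤ, kSummand R (A (κ + 1) ⧸ LinearMap.range (d (κ + 1))) ∧
        (∀ i : ℤ, i < κ → ¬ kSummand R (A (i + 1) ⧸ LinearMap.range (d (i + 1)))) ∧
        ∃ a : ℕ, 0 < a ∧ (∀ i : ℤ, i ≤ κ → Module.finrank R (A i) = a) ∧
          (∀ i : ℤ, κ ≤ i → Module.finrank R (A i) < Module.finrank R (A (i + 1))) ∧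
          ∀ i : ℤ, i ≤ κ →
            moduleLength R (A (i + 1) ⧸ LinearMap.range (d (i + 1))) = (a : ℕ∞) * embdim R) := by
  haveI hart : IsArtinianRing R := (isArtinianRing_iff_isNilpotent_maximalIdeal R).mpr ⟨3, h3⟩
  obtain ⟨e, he, hef⟩ := TB.ln_max (R := R)
  have hef1 : TB.ln R (⊤ : Ideal R) = 1 + e + TB.ln R (maximalIdeal R ^ 2) := by
    rw [TB.ln_ring_top, hef, add_assoc]
  obtain ⟨f, hf⟩ : ∃ f, TB.ln R (maximalIdeal R ^ 2) = f := ⟨_, rfl⟩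
  obtain ⟨r, hr⟩ : ∃ r, TB.ln R (socle R) = r := ⟨_, rfl⟩
  rw [hf] at hef hef1
  have hf1 : 1 ≤ f := by
    have := TB.ln_strict (bot_lt_iff_ne_bot.mpr h2)
    omega
  have hr2 : 2 ≤ r := by
    rw [socdim, TB.moduleLength_eq, ← TB.coe_ln, hr] at hnotGor
    exact_mod_cast hnotGor
  have hfr : f ≤ r := by
    rw [← hf, ← hr]; exact TB.ln_mono (TB.sq_le_socle h3)
  have hsm : socle R < maximalIdeal R := by
    refine lt_of_le_of_ne (IsLocalRing.le_maximalIdeal fun h => ?_) fun h => ?_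
    · apply h2
      have h1 : (1 : R) ∈ socle R := h ▸ trivial
      rw [TB.mem_socle] at h1
      have hb : maximalIdeal R = ⊥ := by
        rw [eq_bot_iff]; intro c hc; simpa using h1 c hc
      rw [hb, pow_two, Ideal.mul_bot]
    · apply h2
      rw [eq_bot_iff, pow_two, Ideal.mul_le]
      intro c hc x hx
      rw [← h, TB.mem_socle] at hx
      exact hx c hc
  have hre : r < e + f := by
    rw [← hef, ← hr]; exact TB.ln_strict hsm
  have hsoc : ∀ i, socle R • (⊤ : Submodule R (A i)) ≤ LinearMap.range (d i) := by
    intro i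
    obtain ⟨j, rfl⟩ : ∃ j, i = j + 1 := ⟨i - 1, by ring⟩
    rw [hacyclic, Submodule.smul_le]
    intro s hs x _
    rw [LinearMap.mem_ker, map_smul]
    have h1 : d j x ∈ maximalIdeal R • (⊤ : Submodule R (A j)) := hmin j ⟨x, rfl⟩
    refine Submodule.smul_induction_on h1 ?_ ?_
    · intro c hc y _
      rw [smul_smul, mul_comm, (TB.mem_socle s).1 hs c hc, zero_smul]
    · intro y z hy hz
      rw [smul_add, hy, hz, add_zero]
  have facts := fun i => TB.pair_facts h3 (hfree i) (hfree (i + 1)) (d i) e f r hef1 hef hf hr (hmin i)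
    (by rw [← hacyclic]; exact hmin _) (hsoc i) (by rw [← hacyclic]; exact hsoc _)
  simp only [← hacyclic] at facts
  choose F1 F2 q F3 F4 F5 using facts
  have F6 : ∀ i, kSummand R (A (i + 1) ⧸ LinearMap.range (d (i + 1))) ↔ 0 < q i := by
    intro i
    rw [hacyclic]
    exact F5 i
  have hGd : f + 1 ≤ e → ∀ j, 0 < q j → ∀ n : ℕ,
      TB.Gd e f (LinearMap.range (d (j + 1 + n))) n := by
    intro hfe j hj n
    induction n with
    | zero =>
      obtain ⟨x, hx, hc⟩ := (TB.kSummand_iff (hfree _) _ (hmin _)).1 ((F6 j).2 hj)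
      have := TB.Gd_start (hfree _) e f _ (hmin (j + 1)) hef x hx hc
      have hidx : j + 1 + ((0 : ℕ) : ℤ) = j + 1 := by simp
      rw [hidx]
      exact this
    | succ n ih =>
      have := TB.Gd_step (hfree _) (d (j + 1 + n)) e f hef1 hf hf1 hfe n ih
      rw [← hacyclic] at this
      have hidx : j + 1 + ((n + 1 : ℕ) : ℤ) = j + 1 + n + 1 := by push_cast; ring
      rw [hidx]
      exact this
  have num := TB.numeric (fun i => (Module.finrank R (A i) : ℤ))
    (fun i => (TB.ln R (LinearMap.range (d i)) : ℤ)) (fun i => (q i : ℤ)) e f r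
    (by exact_mod_cast hf1) (by exact_mod_cast hr2) (by exact_mod_cast hfr) (by exact_mod_cast hre)
    (by
      obtain ⟨i, hi⟩ := hnz
      refine ⟨i, ?_⟩
      have : 0 < Module.finrank R (A i) := Module.finrank_pos_iff_of_free R (A i) |>.mpr hi
      positivity)
    (fun i => by positivity) (fun i => by positivity)
    (fun i => by exact_mod_cast F1 i) (fun i => by exact_mod_cast F3 i)
    (fun i => by exact_mod_cast F4 i) (fun i => by exact_mod_cast F2 i)
    (fun i => by
      have h := TB.ln_mono ((Submodule.smul_mono (TB.sq_le_socle h3) le_rfl).trans (hsoc i))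
      rw [TB.ln_smul_top (hfree i), hf, mul_comm] at h
      exact_mod_cast h)
    (fun i => by
      have h := TB.ln_mono (hmin i)
      rw [TB.ln_smul_top (hfree i), hef, mul_comm] at h
      exact_mod_cast h)
    (fun hfe j hj n => by
      have h := TB.Gd_le e f _ n (hGd (by exact_mod_cast hfe) j (by exact_mod_cast hj) n)
      exact_mod_cast h)
  obtain ⟨hpos, num⟩ := num
  have hlen : ∀ i, moduleLength R (A (i + 1) ⧸ LinearMap.range (d (i + 1))) =
      (TB.ln R (LinearMap.range (d i)) : ℕ∞) := by
    intro i
    rw [TB.moduleLength_eq, TB.coe_ln, hacyclic]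
    exact (d i).quotKerEquivRange.length_eq
  rcases num with ⟨hq0, ha, hz⟩ | ⟨κ, hκ, hlt, hconst, hstr, hz⟩
  · left
    have hns : ∀ i, ¬ kSummand R (A (i + 1) ⧸ LinearMap.range (d (i + 1))) := by
      intro i hk
      have h1 := (F6 i).1 hk
      have h2 := hq0 i
      omega
    refine ⟨⟨?_, Module.finrank R (A 0), by exact_mod_cast hpos 0, fun i => by exact_mod_cast ha i, ?_⟩, ?_⟩
    · intro i
      obtain ⟨j, rfl⟩ : ∃ j, i = j + 1 := ⟨i - 1, by ring⟩
      exact hns j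
    · intro i
      obtain ⟨j, rfl⟩ : ∃ j, i = j + 1 := ⟨i - 1, by ring⟩
      rw [hlen, he]
      exact_mod_cast hz j
    · rintro ⟨κ, hκ, -⟩
      exact hns κ hκ
  · right
    refine ⟨⟨κ, (F6 κ).2 (by exact_mod_cast hκ), ?_, Module.finrank R (A κ), by exact_mod_cast hpos κ,
      fun i hi => by exact_mod_cast hconst i hi, fun i hi => by exact_mod_cast hstr i hi, ?_⟩, ?_⟩
    · intro i hi hk
      have h1 := (F6 i).1 hk
      have h2 := hlt i hi
      omega
    · intro i hi
      rw [hlen, he]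
      exact_mod_cast hz i hi
    · rintro ⟨hns, -⟩
      exact hns (κ + 1) ((F6 κ).2 (by exact_mod_cast hκ))
end
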